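/- arXiv:1210.1014 — 3 statements merged into one kernel-verified Lean document; each statement's English description precedes it below -/
import Mathlib

section
/- Consider a learning graph whose vertices are labeled by k-partite graphs on [n], together with a set of flows {p_y} on which the symmetric group S_n acts transitively. Let V be the set of learning-graph vertices at some fixed level. Then the flows {p_y} are consistent with the collection {[u]⁺ : u ∈ V}, and similarly the flows {p_y} are consistent with {[u]⁻ : u ∈ V}. -/
open scoped Classical

/-- A learning graph: a rooted weighted DAG with positive edge weights, edge
lengths, and a unit flow from the root for each `y : Y`. -/
structure LearningGraph (V Y : Type) where
  root : V
  Edges : Finset (V × V)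
  w : V × V → ℝ
  len : V × V → ℕ
  p : Y → V × V → ℝ
  w_pos : ∀ e ∈ Edges, 0 < w e
  p_nonneg : ∀ y e, 0 ≤ p y e
  p_supp : ∀ y e, e ∉ Edges → p y e = 0
  unit_flow : ∀ y,
    (∑ e ∈ Edges.filter (fun e => e.1 = root), p y e)
      - (∑ e ∈ Edges.filter (fun e => e.2 = root), p y e) = 1
  flow_cons : ∀ y v, v ≠ root →
    (∑ e ∈ Edges.filter (fun e => e.1 = v), p y e)
      ≤ (∑ e ∈ Edges.filter (fun e => e.2 = v), p y e)

namespace LearningGraph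

variable {V Y : Type}

/-- Negative complexity `C₀(E) = Σ_{e ∈ E} ℓ(e)·w(e)`, with respect to an
arbitrary weight function `w`. -/
noncomputable def C0 (G : LearningGraph V Y) (w : V × V → ℝ) (S : Finset (V × V)) : ℝ :=
  ∑ e ∈ S, (G.len e : ℝ) * w e

/-- Positive complexity under the flow `p_y`:
`C_{1,y}(E) = Σ_{e ∈ E} (ℓ(e)/w(e))·p_y(e)²`. -/
noncomputable def C1y (G : LearningGraph V Y) (w : V × V → ℝ) (y : Y) (S : Finset (V × V)) : ℝ :=
  ∑ e ∈ S, ((G.len e : ℝ) / w e) * (G.p y e) ^ 2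

/-- Positive complexity `C₁(E) = max_y C_{1,y}(E)`. -/
noncomputable def C1 (G : LearningGraph V Y) (w : V × V → ℝ) (S : Finset (V × V)) : ℝ :=
  ⨆ y : Y, G.C1y w y S

/-- Complexity `C(E) = √(C₀(E)·C₁(E))` of a set of edges, with respect to the
weight function `w`. -/
noncomputable def cost (G : LearningGraph V Y) (w : V × V → ℝ) (S : Finset (V × V)) : ℝ :=
  Real.sqrt (G.C0 w S * G.C1 w S)

end LearningGraph

/-- A `k`-partite graph on `[n]`: color classes `A 0, …, A (k-1) ⊆ [n]`
together with a set of (undirected) edges. -/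
structure KPartiteGraph (k n : ℕ) where
  A : Fin k → Finset (Fin n)
  edges : Finset (Sym2 (Fin n))

namespace KPartiteGraph

/-- The action of a permutation `σ ∈ S_n` on a `k`-partite graph: the color
classes become `σ(A_1), …, σ(A_k)` and each edge `{i,j}` becomes `{σ i, σ j}`. -/
noncomputable def act {k n : ℕ} (σ : Equiv.Perm (Fin n)) (u : KPartiteGraph k n) :
    KPartiteGraph k n :=
  ⟨fun i => (u.A i).image σ, u.edges.image (Sym2.map σ)⟩

/-- The equivalence class `[u] = {σ(u) : σ ∈ S_n}` of a `k`-partite graph. -/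
noncomputable def orbit {k n : ℕ} (u : KPartiteGraph k n) : Finset (KPartiteGraph k n) :=
  Finset.image (fun σ : Equiv.Perm (Fin n) => act σ u) Finset.univ

end KPartiteGraph

/-- `S_n` acts transitively on the flows `{p_y}`: for all `y, y'` there is
`τ ∈ S_n` with `p_y((u,v)) = p_{y'}((τ u, τ v))` for all `(u, v)`. -/
def ActsTransitively {k n : ℕ} {Y : Type} (G : LearningGraph (KPartiteGraph k n) Y) : Prop :=
  ∀ y y' : Y, ∃ τ : Equiv.Perm (Fin n), ∀ u v : KPartiteGraph k n,
    G.p y (u, v) = G.p y' (KPartiteGraph.act τ u, KPartiteGraph.act τ v)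

namespace KPartiteGraph

variable {k n : ℕ}

theorem act_act (σ τ : Equiv.Perm (Fin n)) (u : KPartiteGraph k n) :
    act σ (act τ u) = act (σ * τ) u := by
  simp only [act, Finset.image_image, Sym2.map_comp, Equiv.Perm.coe_mul]

theorem act_one (u : KPartiteGraph k n) : act 1 u = u := by
  simp [act]

/-- The action of a permutation, as a bijection on `k`-partite graphs. -/
noncomputable def actEquiv (σ : Equiv.Perm (Fin n)) :
    KPartiteGraph k n ≃ KPartiteGraph k n where
  toFun := act σ
  invFun := act σ⁻¹
  left_inv u := by rw [act_act, inv_mul_cancel, act_one]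
  right_inv u := by rw [act_act, mul_inv_cancel, act_one]

theorem act_mem_orbit_iff (σ : Equiv.Perm (Fin n)) (u v : KPartiteGraph k n) :
    act σ v ∈ orbit u ↔ v ∈ orbit u := by
  simp only [orbit, Finset.mem_image, Finset.mem_univ, true_and]
  constructor
  · rintro ⟨τ, h⟩
    exact ⟨σ⁻¹ * τ, by rw [← act_act, h, act_act, inv_mul_cancel, act_one]⟩
  · rintro ⟨τ, rfl⟩
    exact ⟨σ * τ, (act_act σ τ u).symm⟩

end KPartiteGraph

theorem LearningGraph.sum_filter_eq_finsum {V Y : Type} (G : LearningGraph V Y) (y : Y)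
    (P : V × V → Prop) [DecidablePred P] :
    ∑ e ∈ G.Edges.filter P, G.p y e = ∑ᶠ e, if P e then G.p y e else 0 := by
  rw [Finset.sum_filter, finsum_eq_sum_of_support_subset]
  intro e he
  by_contra h
  exact he (by simp [G.p_supp y e h])

/-- If `τ` carries the flow `p_y` to `p_{y'}`, then both flows agree on every set of edges
described by a `τ`-invariant predicate. -/
theorem LearningGraph.sum_filter_eq_of_invariant {k n : ℕ} {Y : Type}
    (G : LearningGraph (KPartiteGraph k n) Y) {y y' : Y} {τ : Equiv.Perm (Fin n)}
    (hτ : ∀ u v, G.p y (u, v) = G.p y' (KPartiteGraph.act τ u, KPartiteGraph.act τ v))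
    (P : KPartiteGraph k n × KPartiteGraph k n → Prop) [DecidablePred P]
    (hP : ∀ u v, P (KPartiteGraph.act τ u, KPartiteGraph.act τ v) ↔ P (u, v)) :
    ∑ e ∈ G.Edges.filter P, G.p y e = ∑ e ∈ G.Edges.filter P, G.p y' e := by
  rw [G.sum_filter_eq_finsum, G.sum_filter_eq_finsum]
  refine finsum_eq_of_bijective _
    ((KPartiteGraph.actEquiv τ).prodCongr (KPartiteGraph.actEquiv τ)).bijective ?_
  rintro ⟨u, v⟩
  simp only [KPartiteGraph.actEquiv, Equiv.prodCongr_apply, Prod.map_apply, Equiv.coe_fn_mk,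
    hP, hτ]

/-- Lemma 6 of LMS11: if `S_n` acts transitively on the flows of a
learning graph whose vertices are labeled by `k`-partite graphs on `[n]`, and
`Vset` is the set of vertices at some given level `L`, then the flows are
consistent with `{[u]⁺ : u ∈ Vset}` and with `{[u]⁻ : u ∈ Vset}`, i.e. the
flow values `p_y([u]⁺)` and `p_y([u]⁻)` are independent of `y`. -/
theorem transitive_action_consistent {k n : ℕ} {Y : Type}
    (G : LearningGraph (KPartiteGraph k n) Y)
    (htrans : ActsTransitively G)
    (lvl : KPartiteGraph k n → ℕ) (hroot : lvl G.root = 0)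
    (hlvl : ∀ e ∈ G.Edges, lvl e.2 = lvl e.1 + 1)
    (L : ℕ) (Vset : Finset (KPartiteGraph k n))
    (hVset : ∀ u : KPartiteGraph k n, u ∈ Vset ↔ lvl u = L) :
    ∀ u ∈ Vset, ∀ y y' : Y,
      (∑ e ∈ G.Edges.filter (fun e => e.1 ∈ KPartiteGraph.orbit u), G.p y e)
        = (∑ e ∈ G.Edges.filter (fun e => e.1 ∈ KPartiteGraph.orbit u), G.p y' e) ∧
      (∑ e ∈ G.Edges.filter (fun e => e.2 ∈ KPartiteGraph.orbit u), G.p y e)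
        = (∑ e ∈ G.Edges.filter (fun e => e.2 ∈ KPartiteGraph.orbit u), G.p y' e) := by
  intro u _ y y'
  obtain ⟨τ, hτ⟩ := htrans y y'
  exact ⟨G.sum_filter_eq_of_invariant hτ _ fun v _ => KPartiteGraph.act_mem_orbit_iff τ u v,
    G.sum_filter_eq_of_invariant hτ _ fun _ v => KPartiteGraph.act_mem_orbit_iff τ u v⟩
end

section
/- Let Triangle_n : {0,1}^{C(n,2)} → {0,1} be the function on undirected n-vertex graphs with Triangle_n(G) = 1 if and only if G contains a triangle (three vertices pairwise joined by edges). Then the learning graph complexity of Triangle_n is O(n^{9/7}): there is a universal constant c such that for every n there exists a learning graph for Triangle_n of complexity at most c·n^{9/7}. (By Belovs' theorem Q(f) = O(LG(f)), this yields a bounded-error quantum query algorithm for triangle detection making O(n^{9/7}) queries.) -/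
open scoped Classical

/-- A learning graph for a (Prop-valued, i.e. `{0,1}`-valued) function
`f : (I → q) → Prop` on inputs indexed by `I`: a rooted weighted DAG with
positive edge weights, a labeling of vertices by index sets that is empty at
the root and monotone along edges (the length of an edge `(u,v)` being
`|S(v) ∖ S(u)|`), and for every positive input `y` a unit flow from the root
terminating only in vertices whose label contains the index set of a
1-certificate for `y`. -/
structure LearningGraphFor {I q : Type} (f : (I → q) → Prop) (V : Type) where
  root : V
  Edges : Finset (V × V)
  w : V × V → ℝ
  lab : V → Finset I
  p : {y : I → q // f y} → V × V → ℝ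
  w_pos : ∀ e ∈ Edges, 0 < w e
  lab_root : lab root = ∅
  lab_mono : ∀ e ∈ Edges, lab e.1 ⊆ lab e.2
  p_nonneg : ∀ y e, 0 ≤ p y e
  p_supp : ∀ y e, e ∉ Edges → p y e = 0
  unit_flow : ∀ y,
    (∑ e ∈ Edges.filter (fun e => e.1 = root), p y e)
      - (∑ e ∈ Edges.filter (fun e => e.2 = root), p y e) = 1
  flow_cons : ∀ y v, v ≠ root →
    (∑ e ∈ Edges.filter (fun e => e.1 = v), p y e)
      ≤ (∑ e ∈ Edges.filter (fun e => e.2 = v), p y e)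
  sink_cert : ∀ (y : {y : I → q // f y}) (v : V),
    (∑ e ∈ Edges.filter (fun e => e.1 = v), p y e)
      < (∑ e ∈ Edges.filter (fun e => e.2 = v), p y e) →
    ∃ C : Finset I, C ⊆ lab v ∧ ∀ z : I → q, (∀ i ∈ C, z i = y.1 i) → f z

namespace LearningGraphFor

variable {I q V : Type} {f : (I → q) → Prop}

/-- The negative complexity `C₀ = Σ_e ℓ(e)·w(e)`, with `ℓ((u,v)) = |S(v) ∖ S(u)|`. -/
noncomputable def C0 (G : LearningGraphFor f V) : ℝ :=
  ∑ e ∈ G.Edges, ((G.lab e.2 \ G.lab e.1).card : ℝ) * G.w e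

/-- The positive complexity `C₁ = max_y Σ_e (ℓ(e)/w(e))·p_y(e)²`. -/
noncomputable def C1 (G : LearningGraphFor f V) : ℝ :=
  ⨆ y : {y : I → q // f y},
    ∑ e ∈ G.Edges, (((G.lab e.2 \ G.lab e.1).card : ℝ) / G.w e) * (G.p y e) ^ 2

/-- The complexity `√(C₀·C₁)` of a learning graph. -/
noncomputable def complexity (G : LearningGraphFor f V) : ℝ :=
  Real.sqrt (G.C0 * G.C1)

end LearningGraphFor

/-- The triangle function on (undirected, loopless) `n`-vertex graphs, whose
inputs are indexed by the `C(n,2)` unordered pairs of distinct vertices: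
`ContainsTriangle n x` holds iff the graph `x` has three vertices pairwise
joined by edges. -/
def ContainsTriangle (n : ℕ) (x : {e : Sym2 (Fin n) // ¬ e.IsDiag} → Bool) : Prop :=
  ∃ a b c : Fin n, a ≠ b ∧ a ≠ c ∧ b ≠ c ∧
    (∀ e : {e : Sym2 (Fin n) // ¬ e.IsDiag}, e.1 = s(a, b) → x e = true) ∧
    (∀ e : {e : Sym2 (Fin n) // ¬ e.IsDiag}, e.1 = s(a, c) → x e = true) ∧
    (∀ e : {e : Sym2 (Fin n) // ¬ e.IsDiag}, e.1 = s(b, c) → x e = true)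

open Finset in
/-- If the flow of every positive input is spread uniformly over a finite family of paths through
`m` layers, and `L k`, `F k` bound the lengths of the edges of layer `k` and the number of paths
through any of them, then the complexity is at most `m * √M` as soon as
`L k ^ 2 * #(E k) * F k ≤ M * #(P y)` for all `k` and `y`. -/
theorem LearningGraphFor.exists_of_uniform_paths {I q T Ω : Type} {f : (I → q) → Prop} {m : ℕ}
    (hm : 0 < m) (lab : T → Finset I) (r : T) (hr : lab r = ∅) (E : ℕ → Finset (T × T))
    (hmono : ∀ k < m, ∀ e ∈ E k, lab e.1 ⊆ lab e.2)
    (L F : ℕ → ℕ) (hLpos : ∀ k < m, 0 < L k)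
    (hL : ∀ k < m, ∀ e ∈ E k, ∃ S : Finset I, S.card ≤ L k ∧
      ∀ i ∈ lab e.2, i ∈ lab e.1 ∨ i ∈ S)
    (P : {y // f y} → Finset Ω) (hP : ∀ y, (P y).Nonempty)
    (path : {y // f y} → Ω → ℕ → T)
    (hroot : ∀ y, ∀ ω ∈ P y, path y ω 0 = r)
    (hpath : ∀ y, ∀ ω ∈ P y, ∀ k < m, (path y ω k, path y ω (k + 1)) ∈ E k)
    (hcert : ∀ y, ∀ ω ∈ P y, ∀ z, (∀ i ∈ lab (path y ω m), z i = y.1 i) → f z)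
    (hF : ∀ y, ∀ k < m, ∀ e, ∀ S ⊆ P y,
      (∀ ω ∈ S, (path y ω k, path y ω (k + 1)) = e) → S.card ≤ F k)
    (M : ℝ) (hM0 : 0 ≤ M)
    (hM : ∀ y, ∀ k < m, (L k : ℝ) ^ 2 * (E k).card * F k ≤ M * (P y).card) :
    ∃ G : LearningGraphFor f (ℕ × T), G.complexity ≤ m * √M := by
  have hP0 : ∀ y, (0 : ℝ) < (P y).card := fun y => by exact_mod_cast (hP y).card_pos
  let layer : ℕ → T × T → (ℕ × T) × (ℕ × T) := fun k e => ((k, e.1), (k + 1, e.2))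
  have layer_inj : ∀ k, Function.Injective (layer k) := by
    rintro k ⟨a, b⟩ ⟨c, d⟩ h
    simpa [layer] using h
  let Edges : Finset ((ℕ × T) × (ℕ × T)) := (range m).biUnion fun k => (E k).image (layer k)
  have mem_Edges : ∀ {e}, e ∈ Edges ↔ ∃ k < m, ∃ d ∈ E k, layer k d = e := by
    intro e
    simp [Edges]
  have sum_Edges : ∀ g : (ℕ × T) × (ℕ × T) → ℝ,
      ∑ e ∈ Edges, g e = ∑ k ∈ range m, ∑ d ∈ E k, g (layer k d) := by
    intro g
    rw [sum_biUnion]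
    · exact sum_congr rfl fun k _ => sum_image (layer_inj k).injOn
    · intro k _ l _ hkl
      refine disjoint_left.2 fun e h₁ h₂ => hkl ?_
      obtain ⟨d, -, rfl⟩ := mem_image.1 h₁
      obtain ⟨d', -, h⟩ := mem_image.1 h₂
      have := congrArg (fun e => e.1.1) h
      simpa [layer] using this.symm
  let w : (ℕ × T) × (ℕ × T) → ℝ := fun e => 1 / (L e.1.1 * (E e.1.1).card)
  let pe : {y // f y} → Ω → ℕ → (ℕ × T) × (ℕ × T) := fun y ω k =>
    layer k (path y ω k, path y ω (k + 1))
  have pe_mem : ∀ y, ∀ ω ∈ P y, ∀ k < m, pe y ω k ∈ Edges := fun y ω hω k hk =>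
    mem_Edges.2 ⟨k, hk, _, hpath y ω hω k hk, rfl⟩
  let p : {y // f y} → (ℕ × T) × (ℕ × T) → ℝ := fun y e =>
    if e ∈ Edges then (((P y).filter fun ω => pe y ω e.1.1 = e).card : ℝ) / (P y).card else 0
  let thru : {y // f y} → ℕ × T → ℝ := fun y v =>
    (((P y).filter fun ω => path y ω v.1 = v.2).card : ℝ) / (P y).card
  have out_eq : ∀ y v, ∑ e ∈ Edges.filter (fun e => e.1 = v), p y e
      = if v.1 < m then thru y v else 0 := by
    rintro y ⟨k, t⟩
    split_ifs with hk
    · have h₁ := card_eq_sum_card_fiberwise (f := fun ω => pe y ω k)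
        (s := (P y).filter fun ω => path y ω k = t)
        (t := Edges.filter (fun e => e.1 = (k, t))) (by
          intro ω hω
          simp only [coe_filter, Set.mem_ofPred_eq] at hω ⊢
          exact ⟨pe_mem y ω hω.1 k hk, by simp [pe, layer, hω.2]⟩)
      simp only [thru]
      rw [h₁, Nat.cast_sum, sum_div]
      refine sum_congr rfl fun e he => ?_
      obtain ⟨he, hv⟩ := mem_filter.1 he
      simp only [p, if_pos he, filter_filter]
      congr 3
      ext ω
      simp only [mem_filter, hv]
      refine and_congr_right fun _ => ⟨fun h => ⟨?_, h⟩, fun h => h.2⟩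
      have := congrArg Prod.fst h
      simpa [pe, layer, hv] using this
    · refine sum_eq_zero fun e he => ?_
      obtain ⟨he, hv⟩ := mem_filter.1 he
      obtain ⟨l, hl, d, -, rfl⟩ := mem_Edges.1 he
      simp only [layer, Prod.mk.injEq] at hv
      exact absurd (hv.1 ▸ hl) hk
  have in_eq : ∀ y v, ∑ e ∈ Edges.filter (fun e => e.2 = v), p y e
      = if 0 < v.1 ∧ v.1 ≤ m then thru y v else 0 := by
    rintro y ⟨k, t⟩
    split_ifs with hk
    · obtain ⟨k, rfl⟩ : ∃ l, k = l + 1 := ⟨k - 1, by simp only at hk; omega⟩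
      have hk' : k < m := by simp only at hk; omega
      have h₁ := card_eq_sum_card_fiberwise (f := fun ω => pe y ω k)
        (s := (P y).filter fun ω => path y ω (k + 1) = t)
        (t := Edges.filter (fun e => e.2 = (k + 1, t))) (by
          intro ω hω
          simp only [coe_filter, Set.mem_ofPred_eq] at hω ⊢
          exact ⟨pe_mem y ω hω.1 k hk', by simp [pe, layer, hω.2]⟩)
      simp only [thru]
      rw [h₁, Nat.cast_sum, sum_div]
      refine sum_congr rfl fun e he => ?_
      obtain ⟨he, hv⟩ := mem_filter.1 he
      simp only [p, if_pos he, filter_filter]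
      have he1 : e.1.1 = k := by
        obtain ⟨l, hl, d, -, rfl⟩ := mem_Edges.1 he
        simp only [layer, Prod.mk.injEq] at hv ⊢
        omega
      congr 3
      ext ω
      simp only [mem_filter, he1]
      refine and_congr_right fun _ => ⟨fun h => ⟨?_, h⟩, fun h => h.2⟩
      have := congrArg Prod.snd h
      simpa [pe, layer, hv] using this
    · refine sum_eq_zero fun e he => ?_
      obtain ⟨he, hv⟩ := mem_filter.1 he
      obtain ⟨l, hl, d, -, rfl⟩ := mem_Edges.1 he
      simp only [layer, Prod.mk.injEq] at hv
      simp only [not_and, not_le] at hk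
      omega
  have thru_nonneg : ∀ y v, 0 ≤ thru y v := fun y v => by positivity
  let G : LearningGraphFor f (ℕ × T) :=
    { root := (0, r)
      Edges := Edges
      w := w
      lab := fun v => lab v.2
      p := p
      w_pos := by
        intro e he
        obtain ⟨k, hk, d, hd, rfl⟩ := mem_Edges.1 he
        have h₁ : (0 : ℝ) < L k := by exact_mod_cast hLpos k hk
        have h₂ : (0 : ℝ) < (E k).card := by exact_mod_cast card_pos.2 ⟨d, hd⟩
        simp only [w, layer]
        positivity
      lab_root := hr
      lab_mono := by
        intro e he
        obtain ⟨k, hk, d, hd, rfl⟩ := mem_Edges.1 he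
        exact hmono k hk d hd
      p_nonneg := by
        intro y e
        simp only [p]
        split_ifs <;> positivity
      p_supp := fun y e he => if_neg he
      unit_flow := by
        intro y
        have h₁ : thru y (0, r) = 1 := by
          simp only [thru]
          rw [filter_true_of_mem (hroot y), div_self (hP0 y).ne']
        have h₂ := out_eq y (0, r)
        have h₃ := in_eq y (0, r)
        simp only [hm, if_true, h₁, lt_irrefl, false_and, if_false] at h₂ h₃
        convert sub_zero (1 : ℝ) using 2
        · convert h₂
        · convert h₃
      flow_cons := by
        intro y v hv
        have h₂ := out_eq y v
        have h₃ := in_eq y v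
        have key : (if v.1 < m then thru y v else 0)
            ≤ if 0 < v.1 ∧ v.1 ≤ m then thru y v else 0 := by
          obtain ⟨k, t⟩ := v
          by_cases hk : 0 < k
          · split_ifs with h₁ h₂
            · exact le_rfl
            · exact absurd ⟨hk, le_of_lt h₁⟩ h₂
            · exact thru_nonneg _ _
            · exact le_rfl
          · obtain rfl : k = 0 := by omega
            have : thru y (0, t) = 0 := by
              simp only [thru]
              rw [filter_false_of_mem, card_empty, Nat.cast_zero, zero_div]
              intro ω hω h
              rw [hroot y ω hω] at h
              exact hv (by rw [h])
            simp [this]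
        rw [← h₂, ← h₃] at key
        convert key
      sink_cert := by
        intro y v hlt
        have h₂ := out_eq y v
        have h₃ := in_eq y v
        have key : (if v.1 < m then thru y v else 0)
            < if 0 < v.1 ∧ v.1 ≤ m then thru y v else 0 := by
          rw [← h₂, ← h₃]
          convert hlt
        obtain ⟨k, t⟩ := v
        have hkm : k = m := by
          by_contra hne
          simp only at key
          split_ifs at key with h₁ h₂ h₂
          · exact lt_irrefl _ key
          · exact absurd key (not_lt.2 (thru_nonneg _ _))
          · omega
          · exact lt_irrefl _ key
        subst hkm
        simp only [lt_irrefl, if_false, hm, le_refl, and_self, if_true] at key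
        have : ((P y).filter fun ω => path y ω k = t).Nonempty := by
          by_contra hne
          rw [not_nonempty_iff_eq_empty] at hne
          simp [thru, hne] at key
        obtain ⟨ω, hω⟩ := this
        obtain ⟨hωP, rfl⟩ := mem_filter.1 hω
        exact ⟨_, Subset.rfl, hcert y ω hωP⟩ }
  have len_le : ∀ k < m, ∀ d ∈ E k,
      ((G.lab (layer k d).2 \ G.lab (layer k d).1).card : ℝ) ≤ L k := by
    intro k hk d hd
    obtain ⟨S, hS, h⟩ := hL k hk d hd
    have : G.lab (layer k d).2 \ G.lab (layer k d).1 ⊆ S := by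
      intro i hi
      obtain ⟨h₁, h₂⟩ := mem_sdiff.1 hi
      exact (h i h₁).resolve_left h₂
    exact_mod_cast (card_le_card this).trans hS
  have hC0 : G.C0 ≤ m := by
    change ∑ e ∈ Edges, ((G.lab e.2 \ G.lab e.1).card : ℝ) * w e ≤ m
    rw [sum_Edges]
    have : ∀ k ∈ range m, ∑ d ∈ E k,
        ((G.lab (layer k d).2 \ G.lab (layer k d).1).card : ℝ) * w (layer k d) ≤ 1 := by
      intro k hk
      have hk := mem_range.1 hk
      have h₁ : (0 : ℝ) < L k := by exact_mod_cast hLpos k hk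
      calc _ ≤ ∑ d ∈ E k, (L k : ℝ) * (1 / (L k * (E k).card)) :=
            sum_le_sum fun d hd => mul_le_mul_of_nonneg_right (len_le k hk d hd) (by positivity)
        _ ≤ 1 := by
            rw [sum_const, nsmul_eq_mul]
            rcases (Nat.cast_nonneg (α := ℝ) (E k).card).eq_or_lt with h | h
            · rw [← h]; simp
            · apply le_of_eq; field_simp
    simpa using sum_le_sum this
  have hC0' : 0 ≤ G.C0 :=
    sum_nonneg fun e he => mul_nonneg (Nat.cast_nonneg _) (G.w_pos e he).le
  have hC1 : G.C1 ≤ m * M := by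
    refine Real.iSup_le (fun y => ?_) (by positivity)
    change ∑ e ∈ Edges, (((G.lab e.2 \ G.lab e.1).card : ℝ) / w e) * (p y e) ^ 2 ≤ m * M
    rw [sum_Edges]
    have : ∀ k ∈ range m, ∑ d ∈ E k,
        (((G.lab (layer k d).2 \ G.lab (layer k d).1).card : ℝ) / w (layer k d)) *
          (p y (layer k d)) ^ 2 ≤ M := by
      intro k hk
      have hk := mem_range.1 hk
      have hp : ∀ d ∈ E k, p y (layer k d) = (((P y).filter fun ω =>
          (path y ω k, path y ω (k + 1)) = d).card : ℝ) / (P y).card := by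
        intro d hd
        have : layer k d ∈ Edges := mem_Edges.2 ⟨k, hk, d, hd, rfl⟩
        simp only [p, if_pos this]
        congr 3
        ext ω
        simp only [mem_filter]
        exact and_congr_right fun _ => (layer_inj k).eq_iff
      have hsum : ∑ d ∈ E k, (((P y).filter fun ω =>
          (path y ω k, path y ω (k + 1)) = d).card : ℝ) = (P y).card := by
        rw [card_eq_sum_card_fiberwise (s := P y) (t := E k)
          (f := fun ω => (path y ω k, path y ω (k + 1))) (fun ω hω => hpath y ω hω k hk)]
        push_cast
        rfl
      have hfib : ∀ d, (((P y).filter fun ω =>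
          (path y ω k, path y ω (k + 1)) = d).card : ℝ) ≤ F k := fun d => by
        exact_mod_cast hF y k hk d _ (filter_subset _ _) (fun ω hω => (mem_filter.1 hω).2)
      have hPy := hP0 y
      calc _ ≤ ∑ d ∈ E k, ((L k : ℝ) ^ 2 * (E k).card * F k / (P y).card ^ 2) *
            ((P y).filter fun ω => (path y ω k, path y ω (k + 1)) = d).card := by
            refine sum_le_sum fun d hd => ?_
            rw [hp d hd]
            simp only [w, layer, one_div, div_inv_eq_mul]
            set x : ℝ := (((P y).filter fun ω => (path y ω k, path y ω (k + 1)) = d).card : ℝ)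
            have h₁ : x ^ 2 ≤ F k * x := by
              rw [sq]
              exact mul_le_mul_of_nonneg_right (hfib d) (Nat.cast_nonneg _)
            calc _ ≤ ((L k : ℝ) * (L k * (E k).card)) * (x / (P y).card) ^ 2 := by
                  gcongr
                  exact_mod_cast len_le k hk d hd
              _ = ((L k : ℝ) ^ 2 * (E k).card / (P y).card ^ 2) * x ^ 2 := by ring
              _ ≤ ((L k : ℝ) ^ 2 * (E k).card / (P y).card ^ 2) * (F k * x) := by gcongr
              _ = _ := by ring
        _ = (L k : ℝ) ^ 2 * (E k).card * F k / (P y).card := by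
            rw [← mul_sum, hsum]
            field_simp
        _ ≤ M := (div_le_iff₀ hPy).2 (hM y k hk)
    simpa using sum_le_sum this
  refine ⟨G, ?_⟩
  have hmM : (m : ℝ) * √M = √((m : ℝ) * (m * M)) := by
    rw [show (m : ℝ) * (m * M) = m ^ 2 * M by ring, Real.sqrt_mul (by positivity),
      Real.sqrt_sq (by positivity)]
  rw [hmM]
  exact Real.sqrt_le_sqrt ((mul_le_mul_of_nonneg_left hC1 hC0').trans
    (mul_le_mul_of_nonneg_right hC0 (by positivity)))

/-- The database of a partially executed triangle search: a state `(A, B, C, D)` has queried the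
pairs in `A × B` and in `C × D`. -/
abbrev TriangleState (n : ℕ) : Type :=
  Finset (Fin n) × Finset (Fin n) × Finset (Fin n) × Finset (Fin n)

namespace TriangleState

open Finset

variable {n : ℕ}

/-- The pairs queried in a given state. -/
noncomputable def queried (t : TriangleState n) : Finset {e : Sym2 (Fin n) // ¬ e.IsDiag} :=
  univ.filter fun e => (∃ a ∈ t.1, ∃ b ∈ t.2.1, e.1 = s(a, b)) ∨
    ∃ c ∈ t.2.2.1, ∃ d ∈ t.2.2.2, e.1 = s(c, d)

lemma mem_queried {t : TriangleState n} {e : {e : Sym2 (Fin n) // ¬ e.IsDiag}} :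
    e ∈ queried t ↔ (∃ a ∈ t.1, ∃ b ∈ t.2.1, e.1 = s(a, b)) ∨
      ∃ c ∈ t.2.2.1, ∃ d ∈ t.2.2.2, e.1 = s(c, d) := by
  simp [queried]

lemma queried_mono {t u : TriangleState n} (h₁ : t.1 ⊆ u.1) (h₂ : t.2.1 ⊆ u.2.1)
    (h₃ : t.2.2.1 ⊆ u.2.2.1) (h₄ : t.2.2.2 ⊆ u.2.2.2) : queried t ⊆ queried u := by
  intro e
  simp only [mem_queried]
  rintro (⟨a, ha, b, hb, h⟩ | ⟨a, ha, b, hb, h⟩)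
  · exact Or.inl ⟨a, h₁ ha, b, h₂ hb, h⟩
  · exact Or.inr ⟨a, h₃ ha, b, h₄ hb, h⟩

lemma exists_finset_pairs (X Y : Finset (Fin n)) :
    ∃ S : Finset {e : Sym2 (Fin n) // ¬ e.IsDiag}, S.card ≤ X.card * Y.card ∧
      ∀ e, (∃ a ∈ X, ∃ b ∈ Y, e.1 = s(a, b)) → e ∈ S := by
  refine ⟨((X ×ˢ Y).image fun z => s(z.1, z.2)).subtype _, ?_, ?_⟩
  · rw [card_subtype, ← card_product]
    exact (card_filter_le _ _).trans card_image_le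
  · rintro e ⟨a, ha, b, hb, h⟩
    rw [mem_subtype, h]
    exact mem_image_of_mem (fun z : Fin n × Fin n => s(z.1, z.2)) (mk_mem_product ha hb)

/-- The pairs `(A, D)` with `D ⊆ A ⊆ U`, `#A = s` and `#D = t`. -/
noncomputable def nested (U : Finset (Fin n)) (s t : ℕ) :
    Finset ((_ : Finset (Fin n)) × Finset (Fin n)) :=
  (U.powersetCard s).sigma fun A => A.powersetCard t

lemma card_nested (U : Finset (Fin n)) (s t : ℕ) :
    (nested U s t).card = U.card.choose s * s.choose t := by
  rw [nested, card_sigma, sum_congr rfl (g := fun _ => s.choose t), sum_const,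
    card_powersetCard, smul_eq_mul]
  intro A hA
  rw [card_powersetCard, (mem_powersetCard.1 hA).2]

lemma mem_nested {U : Finset (Fin n)} {s t : ℕ} {A D : Finset (Fin n)} :
    (⟨A, D⟩ : (_ : Finset (Fin n)) × Finset (Fin n)) ∈ nested U s t ↔
      (A ⊆ U ∧ A.card = s) ∧ D ⊆ A ∧ D.card = t := by
  simp [nested, mem_powersetCard]

/-- The transitions of the learning graph: load `A × B`, add a vertex to `A`, add a vertex to `B`,
connect a new vertex `c` to `l` vertices `D` of `A`, add a vertex of `A` to `D`, add a vertex of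
`B` to `D`. -/
noncomputable def transitions (n r s l : ℕ) : ℕ → Finset (TriangleState n × TriangleState n)
  | 0 => (univ.powersetCard r ×ˢ univ.powersetCard s).image fun x =>
      ((∅, ∅, ∅, ∅), (x.1, x.2, ∅, ∅))
  | 1 => ((univ.powersetCard r ×ˢ univ.powersetCard s) ×ˢ univ).image fun x =>
      ((x.1.1, x.1.2, ∅, ∅), (insert x.2 x.1.1, x.1.2, ∅, ∅))
  | 2 => ((univ.powersetCard (r + 1) ×ˢ univ.powersetCard s) ×ˢ univ).image fun x =>
      ((x.1.1, x.1.2, ∅, ∅), (x.1.1, insert x.2 x.1.2, ∅, ∅))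
  | 3 => ((nested univ (r + 1) l ×ˢ univ.powersetCard (s + 1)) ×ˢ univ).image fun x =>
      ((x.1.1.1, x.1.2, ∅, ∅), (x.1.1.1, x.1.2, {x.2}, x.1.1.2))
  | 4 => ((nested univ (r + 1) l ×ˢ univ.powersetCard (s + 1)) ×ˢ univ).biUnion fun x =>
      x.1.1.1.image fun a =>
        ((x.1.1.1, x.1.2, {x.2}, x.1.1.2), (x.1.1.1, x.1.2, {x.2}, insert a x.1.1.2))
  | 5 => ((nested univ (r + 1) (l + 1) ×ˢ univ.powersetCard (s + 1)) ×ˢ univ).biUnion fun x =>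
      x.1.2.image fun b =>
        ((x.1.1.1, x.1.2, {x.2}, x.1.1.2), (x.1.1.1, x.1.2, {x.2}, insert b x.1.1.2))
  | _ => ∅

/-- Upper bounds for the lengths of the transitions. -/
def lengthBound (r s l : ℕ) : ℕ → ℕ
  | 0 => r * s
  | 1 => s
  | 2 => r + 1
  | 3 => l
  | _ => 1

/-- Upper bounds for the number of transitions. -/
def countBound (n r s l : ℕ) : ℕ → ℕ
  | 0 => n.choose r * n.choose s
  | 1 => n.choose r * n.choose s * n
  | 2 => n.choose (r + 1) * n.choose s * n
  | 3 => n.choose (r + 1) * (r + 1).choose l * n.choose (s + 1) * n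
  | 4 => n.choose (r + 1) * (r + 1).choose l * n.choose (s + 1) * n * (r + 1)
  | 5 => n.choose (r + 1) * (r + 1).choose (l + 1) * n.choose (s + 1) * n * (s + 1)
  | _ => 0

/-- Upper bounds for the number of paths through a transition. -/
def fiberBound (r l : ℕ) : ℕ → ℕ
  | 0 => r.choose l
  | 1 => r.choose l
  | 2 => r.choose l
  | _ => 1

lemma card_transitions_le (n r s l k : ℕ) :
    (transitions n r s l k).card ≤ countBound n r s l k := by
  match k with
  | 0 | 1 | 2 | 3 =>
    refine card_image_le.trans_eq ?_
    simp [card_product, card_nested, countBound]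
  | 4 =>
    refine (card_biUnion_le_card_mul _ _ (r + 1) fun x hx => card_image_le.trans_eq ?_).trans_eq ?_
    · obtain ⟨⟨⟨A, D⟩, B⟩, c⟩ := x
      simp only [mem_product, mem_nested] at hx
      exact hx.1.1.1.2
    · simp [card_product, card_nested, countBound]
  | 5 =>
    refine (card_biUnion_le_card_mul _ _ (s + 1) fun x hx => card_image_le.trans_eq ?_).trans_eq ?_
    · obtain ⟨⟨⟨A, D⟩, B⟩, c⟩ := x
      simp only [mem_product, mem_powersetCard] at hx
      exact hx.1.2.2
    · simp [card_product, card_nested, countBound]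
  | k + 6 => simp [transitions, countBound]

lemma queried_subset_of_mem_transitions {r s l k : ℕ} {e : TriangleState n × TriangleState n}
    (he : e ∈ transitions n r s l k) : queried e.1 ⊆ queried e.2 := by
  match k with
  | 0 | 1 | 2 | 3 =>
    obtain ⟨x, -, rfl⟩ := mem_image.1 he
    apply queried_mono <;> simp
  | 4 | 5 =>
    obtain ⟨x, -, he⟩ := mem_biUnion.1 he
    obtain ⟨a, -, rfl⟩ := mem_image.1 he
    apply queried_mono <;> simp
  | k + 6 => simp [transitions] at he

lemma exists_new_queries_of_mem_transitions {r s l k : ℕ}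
    {e : TriangleState n × TriangleState n} (he : e ∈ transitions n r s l k) :
    ∃ S : Finset {e : Sym2 (Fin n) // ¬ e.IsDiag}, S.card ≤ lengthBound r s l k ∧
      ∀ i ∈ queried e.2, i ∈ queried e.1 ∨ i ∈ S := by
  suffices ∃ X Y : Finset (Fin n), X.card * Y.card ≤ lengthBound r s l k ∧
      ∀ i ∈ queried e.2, i ∈ queried e.1 ∨ ∃ a ∈ X, ∃ b ∈ Y, i.1 = s(a, b) by
    obtain ⟨X, Y, hXY, h⟩ := this
    obtain ⟨S, hS, hS'⟩ := exists_finset_pairs X Y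
    exact ⟨S, hS.trans hXY, fun i hi => (h i hi).imp_right (hS' i)⟩
  match k with
  | 0 =>
    obtain ⟨⟨A, B⟩, hx, rfl⟩ := mem_image.1 he
    simp only [mem_product, mem_powersetCard] at hx
    refine ⟨A, B, by simp [hx.1.2, hx.2.2, lengthBound], fun i hi => ?_⟩
    simpa [mem_queried] using hi
  | 1 =>
    obtain ⟨⟨⟨A, B⟩, a⟩, hx, rfl⟩ := mem_image.1 he
    simp only [mem_product, mem_powersetCard] at hx
    refine ⟨{a}, B, by simp [hx.1.2.2, lengthBound], fun i hi => ?_⟩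
    simp only [mem_queried, mem_insert, mem_singleton] at hi ⊢
    grind
  | 2 =>
    obtain ⟨⟨⟨A, B⟩, b⟩, hx, rfl⟩ := mem_image.1 he
    simp only [mem_product, mem_powersetCard] at hx
    refine ⟨A, {b}, by simp [hx.1.1.2, lengthBound], fun i hi => ?_⟩
    simp only [mem_queried, mem_insert, mem_singleton] at hi ⊢
    grind
  | 3 =>
    obtain ⟨⟨⟨⟨A, D⟩, B⟩, c⟩, hx, rfl⟩ := mem_image.1 he
    simp only [mem_product, mem_nested] at hx
    refine ⟨{c}, D, by simp [hx.1.1.2.2, lengthBound], fun i hi => ?_⟩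
    simp only [mem_queried, mem_singleton] at hi ⊢
    grind
  | 4 | 5 =>
    obtain ⟨⟨⟨⟨A, D⟩, B⟩, c⟩, -, he⟩ := mem_biUnion.1 he
    obtain ⟨a, -, rfl⟩ := mem_image.1 he
    refine ⟨{c}, {a}, by simp [lengthBound], fun i hi => ?_⟩
    simp only [mem_queried, mem_insert, mem_singleton] at hi ⊢
    grind
  | k + 6 => simp [transitions] at he

/-- The choices `((A, D), B)` made by a path towards a triangle `a, b, c`. -/
noncomputable def choices (r s l : ℕ) (a b : Fin n) :
    Finset (((_ : Finset (Fin n)) × Finset (Fin n)) × Finset (Fin n)) :=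
  nested (univ.erase a) r l ×ˢ (univ.erase b).powersetCard s

lemma card_choices (r s l : ℕ) (a b : Fin n) :
    (choices r s l a b).card = (n - 1).choose r * r.choose l * (n - 1).choose s := by
  simp [choices, card_product, card_nested]

lemma mem_choices {r s l : ℕ} {a b : Fin n} {A D B : Finset (Fin n)} :
    ((⟨A, D⟩, B) : ((_ : Finset (Fin n)) × Finset (Fin n)) × Finset (Fin n)) ∈ choices r s l a b ↔
      ((a ∉ A ∧ A.card = r) ∧ D ⊆ A ∧ D.card = l) ∧ b ∉ B ∧ B.card = s := by
  simp [choices, mem_nested, mem_powersetCard, subset_erase]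

/-- The path towards the triangle `a, b, c` given by the choices `((A, D), B)`. -/
noncomputable def path (a b c : Fin n)
    (ω : ((_ : Finset (Fin n)) × Finset (Fin n)) × Finset (Fin n)) : ℕ → TriangleState n
  | 0 => (∅, ∅, ∅, ∅)
  | 1 => (ω.1.1, ω.2, ∅, ∅)
  | 2 => (insert a ω.1.1, ω.2, ∅, ∅)
  | 3 => (insert a ω.1.1, insert b ω.2, ∅, ∅)
  | 4 => (insert a ω.1.1, insert b ω.2, {c}, ω.1.2)
  | 5 => (insert a ω.1.1, insert b ω.2, {c}, insert a ω.1.2)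
  | _ => (insert a ω.1.1, insert b ω.2, {c}, insert b (insert a ω.1.2))

lemma path_mem_transitions {r s l k : ℕ} {a b c : Fin n}
    {ω : ((_ : Finset (Fin n)) × Finset (Fin n)) × Finset (Fin n)}
    (hω : ω ∈ choices r s l a b) (hk : k < 6) :
    (path a b c ω k, path a b c ω (k + 1)) ∈ transitions n r s l k := by
  obtain ⟨⟨A, D⟩, B⟩ := ω
  obtain ⟨⟨⟨ha, hA⟩, hDA, hD⟩, hb, hB⟩ := mem_choices.1 hω
  have hA' : (insert a A).card = r + 1 := by rw [card_insert_of_notMem ha, hA]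
  have hB' : (insert b B).card = s + 1 := by rw [card_insert_of_notMem hb, hB]
  have hD' : (insert a D).card = l + 1 := by rw [card_insert_of_notMem (fun h => ha (hDA h)), hD]
  have hDA' : D ⊆ insert a A := hDA.trans (subset_insert _ _)
  interval_cases k
  · exact mem_image.2 ⟨(A, B), by simp [mem_powersetCard, hA, hB], rfl⟩
  · exact mem_image.2 ⟨((A, B), a), by simp [mem_powersetCard, hA, hB], rfl⟩
  · exact mem_image.2 ⟨((insert a A, B), b), by simp [mem_powersetCard, hA', hB], rfl⟩
  · exact mem_image.2 ⟨((⟨insert a A, D⟩, insert b B), c),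
      by simp [mem_powersetCard, mem_nested, hA', hB', hD, hDA'], rfl⟩
  · exact mem_biUnion.2 ⟨((⟨insert a A, D⟩, insert b B), c),
      by simp [mem_powersetCard, mem_nested, hA', hB', hD, hDA'],
      mem_image.2 ⟨a, mem_insert_self _ _, rfl⟩⟩
  · exact mem_biUnion.2 ⟨((⟨insert a A, insert a D⟩, insert b B), c),
      by simp [mem_powersetCard, mem_nested, hA', hB', hD', insert_subset_insert, hDA],
      mem_image.2 ⟨b, mem_insert_self _ _, rfl⟩⟩

lemma insert_injective_of_notMem {a : Fin n} {A A' : Finset (Fin n)} (h : a ∉ A) (h' : a ∉ A')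
    (hAA : insert a A = insert a A') : A = A' := by
  rw [← erase_insert h, hAA, erase_insert h']

lemma card_fiber_le {r s l k : ℕ} {a b c : Fin n} (hk : k < 6)
    {e : TriangleState n × TriangleState n}
    {S : Finset (((_ : Finset (Fin n)) × Finset (Fin n)) × Finset (Fin n))}
    (hS : S ⊆ choices r s l a b)
    (he : ∀ ω ∈ S, (path a b c ω k, path a b c ω (k + 1)) = e) :
    S.card ≤ fiberBound r l k := by
  have hAB : ∀ ω ∈ S, ∀ ω' ∈ S, ω.1.1 = ω'.1.1 ∧ ω.2 = ω'.2 ∧ (3 ≤ k → ω.1.2 = ω'.1.2) := by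
    rintro ⟨⟨A, D⟩, B⟩ hω ⟨⟨A', D'⟩, B'⟩ hω'
    have heq := (he _ hω).trans (he _ hω').symm
    obtain ⟨⟨⟨ha, -⟩, hDA, -⟩, hb, -⟩ := mem_choices.1 (hS hω)
    obtain ⟨⟨⟨ha', -⟩, hDA', -⟩, hb', -⟩ := mem_choices.1 (hS hω')
    have hD := fun h => ha (hDA h)
    have hD' := fun h => ha' (hDA' h)
    have iA := insert_injective_of_notMem ha ha'
    have iB := insert_injective_of_notMem hb hb'
    have iD := insert_injective_of_notMem hD hD'
    interval_cases k <;> simp only [path, Prod.mk.injEq] at heq <;>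
      refine ⟨?_, ?_, fun h => ?_⟩ <;> first | omega | tauto
  have hone : 3 ≤ k → S.card ≤ 1 := fun h3 => card_le_one.2 fun ω hω ω' hω' => by
    obtain ⟨h₁, h₂, h₃⟩ := hAB ω hω ω' hω'
    have h₃ := h₃ h3
    obtain ⟨⟨A, D⟩, B⟩ := ω
    obtain ⟨⟨A', D'⟩, B'⟩ := ω'
    simp only at h₁ h₂ h₃
    rw [h₁, h₂, h₃]
  have hchoose : S.card ≤ r.choose l := by
    rcases S.eq_empty_or_nonempty with rfl | ⟨ω₀, hω₀⟩
    · simp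
    obtain ⟨⟨A, D⟩, B⟩ := ω₀
    obtain ⟨⟨⟨-, hA⟩, -⟩, -⟩ := mem_choices.1 (hS hω₀)
    rw [← hA, ← card_powersetCard]
    refine card_le_card_of_injOn (fun ω => ω.1.2) ?_ ?_
    · rintro ⟨⟨A', D'⟩, B'⟩ hω
      obtain ⟨-, hDA', hD'⟩ := (mem_choices.1 (hS hω)).1
      have : A' = A := (hAB _ hω _ hω₀).1
      subst this
      simp [mem_powersetCard, hDA', hD']
    · rintro ⟨⟨A', D'⟩, B'⟩ hω ⟨⟨A'', D''⟩, B''⟩ hω' h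
      obtain ⟨h₁, h₂, -⟩ := hAB _ hω _ hω'
      simp only at h₁ h₂ h
      rw [h₁, h₂, h]
  interval_cases k
  · exact hchoose
  · exact hchoose
  · exact hchoose
  all_goals exact hone (by norm_num)

end TriangleState

lemma Nat.choose_succ_le_eight_mul_choose {n k : ℕ} (h : 8 * k ≤ 7 * (n + 1)) :
    (n + 1).choose k ≤ 8 * n.choose k := by
  refine Nat.le_of_mul_le_mul_right ?_ n.succ_pos
  calc (n + 1).choose k * (n + 1) ≤ (n + 1).choose k * (8 * (n + 1 - k)) := by gcongr; omega
    _ = 8 * (n.choose k * (n + 1)) := by rw [Nat.choose_mul_succ_eq]; ring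
    _ = 8 * n.choose k * (n + 1) := by ring

lemma Nat.cast_choose_succ_le {n k : ℕ} {u v : ℝ} (hv : 0 < v) (hk : v ≤ k + 1)
    (hn : (n : ℝ) = u * v) : (n.choose (k + 1) : ℝ) ≤ n.choose k * u := by
  refine le_of_mul_le_mul_right ?_ hv
  calc (n.choose (k + 1) : ℝ) * v ≤ n.choose (k + 1) * (k + 1) := by gcongr
    _ = n.choose k * ((n - k : ℕ) : ℝ) := by exact_mod_cast Nat.choose_succ_right_eq n k
    _ ≤ n.choose k * n := by gcongr; exact Nat.sub_le _ _
    _ = n.choose k * u * v := by rw [hn]; ring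

namespace TriangleState

lemma cost_le {n r s l k : ℕ} {x : ℝ} (hx : 8 / 7 ≤ x) (hn : (n : ℝ) = x ^ 7)
    (hr : (r : ℝ) ≤ x ^ 4) (hr' : x ^ 4 ≤ r + 1) (hs : (s : ℝ) ≤ x ^ 5) (hs' : x ^ 5 ≤ s + 1)
    (hl : (l : ℝ) ≤ x ^ 3) (hl' : x ^ 3 ≤ l + 1) (hk : k < 6) :
    (lengthBound r s l k : ℝ) ^ 2 * countBound n r s l k * fiberBound r l k ≤
      1024 * x ^ 18 * ((n - 1).choose r * r.choose l * (n - 1).choose s : ℕ) := by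
  have hx0 : 0 < x := by linarith
  have hx1 : 1 ≤ x := by linarith
  have hx8 : 8 ≤ 7 * x := by linarith
  obtain ⟨n, rfl⟩ : ∃ n', n = n' + 1 := by
    refine ⟨n - 1, (Nat.succ_pred_eq_of_pos ?_).symm⟩
    have : (0 : ℝ) < n := by rw [hn]; positivity
    exact_mod_cast this
  have hpow : ∀ i j : ℕ, i < j → 8 * x ^ i ≤ 7 * x ^ j := fun i j hij => by
    calc 8 * x ^ i ≤ 7 * x * x ^ i := by gcongr
      _ = 7 * x ^ (i + 1) := by ring
      _ ≤ 7 * x ^ j := by gcongr; exact hij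
  have h₁ : ((n + 1).choose r : ℝ) ≤ 8 * n.choose r := by
    have : (8 * r : ℝ) ≤ 7 * (n + 1 : ℕ) := by rw [hn]; linarith [hpow 4 7 (by norm_num)]
    exact_mod_cast Nat.choose_succ_le_eight_mul_choose (by exact_mod_cast this)
  have h₂ : ((n + 1).choose s : ℝ) ≤ 8 * n.choose s := by
    have : (8 * s : ℝ) ≤ 7 * (n + 1 : ℕ) := by rw [hn]; linarith [hpow 5 7 (by norm_num)]
    exact_mod_cast Nat.choose_succ_le_eight_mul_choose (by exact_mod_cast this)
  have h₃ : ((r + 1).choose l : ℝ) ≤ 8 * r.choose l := by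
    have : (8 * l : ℝ) ≤ 7 * (r + 1) := by linarith [hpow 3 4 (by norm_num)]
    exact_mod_cast Nat.choose_succ_le_eight_mul_choose (by exact_mod_cast this)
  have hone : ∀ i : ℕ, 1 ≤ x ^ i := fun i => one_le_pow₀ hx1
  have hr2 : (r : ℝ) + 1 ≤ 2 * x ^ 4 := by linarith [hone 4]
  have hs2 : (s : ℝ) + 1 ≤ 2 * x ^ 5 := by linarith [hone 5]
  have h₄ : ((n + 1).choose (r + 1) : ℝ) ≤ 8 * n.choose r * x ^ 3 :=
    (Nat.cast_choose_succ_le (u := x ^ 3) (by positivity) hr' (by rw [hn]; ring)).trans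
      (by gcongr)
  have h₅ : ((n + 1).choose (s + 1) : ℝ) ≤ 8 * n.choose s * x ^ 2 :=
    (Nat.cast_choose_succ_le (u := x ^ 2) (by positivity) hs' (by rw [hn]; ring)).trans
      (by gcongr)
  have h₆ : ((r + 1).choose (l + 1) : ℝ) ≤ r.choose l * (2 * x) := by
    refine le_of_mul_le_mul_right ?_ (show 0 < x ^ 3 by positivity)
    calc ((r + 1).choose (l + 1) : ℝ) * x ^ 3 ≤ (r + 1).choose (l + 1) * (l + 1) := by gcongr
      _ = (r + 1) * r.choose l := by exact_mod_cast (Nat.add_one_mul_choose_eq r l).symm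
      _ ≤ (2 * x ^ 4) * r.choose l := by gcongr
      _ = r.choose l * (2 * x) * x ^ 3 := by ring
  set p : ℝ := (n.choose r : ℝ)
  set q : ℝ := (n.choose s : ℝ)
  set t : ℝ := (r.choose l : ℝ)
  have hp : 0 ≤ p := Nat.cast_nonneg _
  have hq : 0 ≤ q := Nat.cast_nonneg _
  have ht : 0 ≤ t := Nat.cast_nonneg _
  have fin : ∀ (C : ℝ) (i : ℕ), 0 ≤ C → C ≤ 1024 → i ≤ 18 →
      C * x ^ i * (p * t * q) ≤ 1024 * x ^ 18 * (p * t * q) := fun C i h0 hC hi => by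
    gcongr
  rw [Nat.add_sub_cancel]
  interval_cases k <;> simp only [lengthBound, countBound, fiberBound, Nat.cast_mul, hn] <;>
    push_cast
  · calc _ ≤ (x ^ 4 * x ^ 5) ^ 2 * (8 * p * (8 * q)) * t := by gcongr
      _ = 64 * x ^ 18 * (p * t * q) := by ring
      _ ≤ _ := fin _ _ (by norm_num) (by norm_num) (by norm_num)
  · calc _ ≤ (x ^ 5) ^ 2 * (8 * p * (8 * q) * x ^ 7) * t := by gcongr
      _ = 64 * x ^ 17 * (p * t * q) := by ring
      _ ≤ _ := fin _ _ (by norm_num) (by norm_num) (by norm_num)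
  · calc _ ≤ (2 * x ^ 4) ^ 2 * (8 * p * x ^ 3 * (8 * q) * x ^ 7) * t := by gcongr
      _ = 256 * x ^ 18 * (p * t * q) := by ring
      _ ≤ _ := fin _ _ (by norm_num) (by norm_num) (by norm_num)
  · calc _ ≤ (x ^ 3) ^ 2 * (8 * p * x ^ 3 * (8 * t) * (8 * q * x ^ 2) * x ^ 7) * 1 := by gcongr
      _ = 512 * x ^ 18 * (p * t * q) := by ring
      _ ≤ _ := fin _ _ (by norm_num) (by norm_num) (by norm_num)
  · calc _ ≤ 1 ^ 2 * (8 * p * x ^ 3 * (8 * t) * (8 * q * x ^ 2) * x ^ 7 * (2 * x ^ 4)) * 1 := by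
          gcongr
      _ = 1024 * x ^ 16 * (p * t * q) := by ring
      _ ≤ _ := fin _ _ (by norm_num) (by norm_num) (by norm_num)
  · calc _ ≤ 1 ^ 2 * (8 * p * x ^ 3 * (t * (2 * x)) * (8 * q * x ^ 2) * x ^ 7 * (2 * x ^ 5)) * 1 := by
          gcongr
      _ = 256 * x ^ 18 * (p * t * q) := by ring
      _ ≤ _ := fin _ _ (by norm_num) (by norm_num) (by norm_num)

theorem exists_learningGraph {n r s l : ℕ} {x : ℝ} (hx : 8 / 7 ≤ x) (hn : (n : ℝ) = x ^ 7)
    (hr : (r : ℝ) ≤ x ^ 4) (hr' : x ^ 4 ≤ r + 1) (hs : (s : ℝ) ≤ x ^ 5) (hs' : x ^ 5 ≤ s + 1)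
    (hl : (l : ℝ) ≤ x ^ 3) (hl' : x ^ 3 ≤ l + 1) (hs0 : 0 < s) (hl0 : 0 < l) (hlr : l ≤ r)
    (hrn : r < n) (hsn : s < n) :
    ∃ G : LearningGraphFor (ContainsTriangle n) (ℕ × TriangleState n),
      G.complexity ≤ 192 * x ^ 9 := by
  have hx0 : 0 < x := by linarith
  choose a b c hab hac hbc yab yac ybc using
    fun y : {y // ContainsTriangle n y} => y.2
  have hcost := fun k (hk : k < 6) => cost_le hx hn hr hr' hs hs' hl hl' hk
  obtain ⟨G, hG⟩ := LearningGraphFor.exists_of_uniform_paths (f := ContainsTriangle n)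
    (m := 6) (by norm_num) queried (∅, ∅, ∅, ∅) (by simp [queried]) (transitions n r s l)
    (fun k _ e he => queried_subset_of_mem_transitions he) (lengthBound r s l) (fiberBound r l)
    (fun k hk => by
      interval_cases k <;> simp only [lengthBound] <;> first | omega | exact Nat.mul_pos (by omega) hs0)
    (fun k _ e he => exists_new_queries_of_mem_transitions he)
    (fun y => choices r s l (a y) (b y))
    (fun y => by
      rw [← Finset.card_pos, card_choices]
      have h₁ := Nat.choose_pos (n := n - 1) (k := r) (by omega)
      have h₂ := Nat.choose_pos (n := n - 1) (k := s) (by omega)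
      have h₃ := Nat.choose_pos hlr
      positivity)
    (fun y => path (a y) (b y) (c y))
    (fun y ω _ => rfl)
    (fun y ω hω k hk => path_mem_transitions hω hk)
    (fun y ω hω z hz => by
      refine ⟨a y, b y, c y, hab y, hac y, hbc y, fun e he => ?_, fun e he => ?_, fun e he => ?_⟩
      · rw [hz e, yab y e he]
        exact mem_queried.2 (Or.inl ⟨a y, by simp [path], b y, by simp [path], he⟩)
      · rw [hz e, yac y e he]
        exact mem_queried.2
          (Or.inr ⟨c y, by simp [path], a y, by simp [path], he.trans Sym2.eq_swap⟩)
      · rw [hz e, ybc y e he]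
        exact mem_queried.2
          (Or.inr ⟨c y, by simp [path], b y, by simp [path], he.trans Sym2.eq_swap⟩))
    (fun y k hk e S hS he => card_fiber_le hk hS he)
    (1024 * x ^ 18) (by positivity)
    (fun y k hk => by
      rw [card_choices]
      refine le_trans ?_ (hcost k hk)
      gcongr
      exact card_transitions_le n r s l k)
  refine ⟨G, hG.trans_eq ?_⟩
  rw [show 1024 * x ^ 18 = (32 * x ^ 9) ^ 2 by ring, Real.sqrt_sq (by positivity)]
  push_cast
  ring

end TriangleState

/-- the learning graph complexity of triangle finding is
`O(n^{9/7})`: there is a universal constant `c > 0` such that for every `n`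
there is a learning graph for `Triangle_n` of complexity at most `c·n^{9/7}`
(hence, by Belovs' theorem, a bounded-error quantum query algorithm for
triangle detection making `O(n^{9/7})` queries). -/
theorem triangle_learning_graph_complexity :
    ∃ c : ℝ, 0 < c ∧ ∀ n : ℕ,
      ∃ (V : Type) (G : LearningGraphFor (ContainsTriangle n) V),
        G.complexity ≤ c * (n : ℝ) ^ ((9 : ℝ) / 7) := by
  refine ⟨192, by norm_num, fun n => ⟨ℕ × TriangleState n, ?_⟩⟩
  rcases lt_or_ge n 3 with hn | hn
  · have hempty : ∀ y : {y // ContainsTriangle n y}, False := by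
      rintro ⟨y, a, b, c, hab, hac, hbc, -⟩
      simp only [ne_eq, Fin.ext_iff] at hab hac hbc
      omega
    obtain ⟨G, hG⟩ := LearningGraphFor.exists_of_uniform_paths (f := ContainsTriangle n)
      (m := 1) (Ω := Unit) one_pos TriangleState.queried (∅, ∅, ∅, ∅)
      (by simp [TriangleState.queried]) (fun _ => ∅) (by simp) (fun _ => 1) (fun _ => 1) (by simp)
      (by simp) (fun y => (hempty y).elim) (fun y => (hempty y).elim) (fun y => (hempty y).elim)
      (fun y => (hempty y).elim) (fun y => (hempty y).elim) (fun y => (hempty y).elim)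
      (fun y => (hempty y).elim) 0 le_rfl (fun y => (hempty y).elim)
    refine ⟨G, hG.trans ?_⟩
    rw [Real.sqrt_zero, mul_zero]
    positivity
  · set x : ℝ := (n : ℝ) ^ ((1 : ℝ) / 7) with hx_def
    have hxn : (n : ℝ) = x ^ 7 := by
      rw [hx_def, ← Real.rpow_natCast, ← Real.rpow_mul (Nat.cast_nonneg n)]
      norm_num
    have hx9 : (n : ℝ) ^ ((9 : ℝ) / 7) = x ^ 9 := by
      rw [hx_def, ← Real.rpow_natCast, ← Real.rpow_mul (Nat.cast_nonneg n)]
      norm_num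
    have hx0 : 0 ≤ x := by positivity
    have hx : 8 / 7 ≤ x := by
      refine le_of_pow_le_pow_left₀ (n := 7) (by norm_num) hx0 ?_
      rw [← hxn]
      calc (8 / 7 : ℝ) ^ 7 ≤ 3 := by norm_num
        _ ≤ n := by exact_mod_cast hn
    have hx1 : 1 < x := by linarith
    have hpos : ∀ i : ℕ, 0 < ⌊x ^ i⌋₊ := fun i => Nat.floor_pos.2 (one_le_pow₀ hx1.le)
    have hle : ∀ i : ℕ, (⌊x ^ i⌋₊ : ℝ) ≤ x ^ i := fun i => Nat.floor_le (by positivity)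
    have hlt : ∀ i : ℕ, x ^ i ≤ ⌊x ^ i⌋₊ + 1 := fun i => (Nat.lt_floor_add_one _).le
    have hltn : ∀ i < 7, ⌊x ^ i⌋₊ < n := fun i hi => by
      rw [Nat.floor_lt (by positivity), hxn]
      exact pow_lt_pow_right₀ hx1 hi
    rw [hx9]
    exact TriangleState.exists_learningGraph hx hxn (hle 4) (hlt 4) (hle 5) (hlt 5) (hle 3) (hlt 3)
      (hpos 5) (hpos 3) (Nat.floor_le_floor (pow_le_pow_right₀ hx1.le (by norm_num)))
      (hltn 4 (by norm_num)) (hltn 5 (by norm_num))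
end

section
/- Let S be a set of size n and identify a binary operation ∘ : S × S → S with its multiplication table, an input x ∈ [n]^{n×n}. Let f : [n]^{n×n} → {0,1} be defined by f(x) = 1 if and only if the operation ∘ given by x is not associative, i.e., there exist a, b, c ∈ S with a ∘ (b ∘ c) ≠ (a ∘ b) ∘ c. Then the learning graph complexity of f is O(n^{10/7}): there is a universal constant c such that for every n there is a learning graph for f of complexity at most c·n^{10/7}. (By Belovs' theorem Q(f) = O(LG(f)), this yields a bounded-error quantum query algorithm making O(n^{10/7}) queries to determine whether ∘ is associative.) -/
open scoped Classical

/-- Non-associativity of the binary operation on `[n]` given by a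
multiplication table `x ∈ [n]^{n×n}`: there are `a, b, c` with
`a ∘ (b ∘ c) ≠ (a ∘ b) ∘ c`. -/
def NotAssociative (n : ℕ) (x : Fin n × Fin n → Fin n) : Prop :=
  ∃ a b c : Fin n, x (a, x (b, c)) ≠ x (x (a, b), c)

section PathFlow

/-- A layered learning graph whose flow for each positive input is the uniform average of a finite
family of root-to-certificate paths that never share an edge of the same layer. -/
theorem exists_learningGraphFor_of_paths {I q K O : Type} {f : (I → q) → Prop} {T : ℕ}
    (hT : 0 < T) (lab : K → Finset I) (k₀ : K) (hk₀ : lab k₀ = ∅)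
    (E : ℕ → Finset (K × K)) (hE : ∀ t < T, ∀ e ∈ E t, lab e.1 ⊆ lab e.2)
    (Ω : {y : I → q // f y} → Finset O) (hΩ : ∀ y, (Ω y).Nonempty)
    (path : {y : I → q // f y} → O → ℕ → K)
    (hpath₀ : ∀ y, ∀ ω ∈ Ω y, path y ω 0 = k₀)
    (hpathE : ∀ y, ∀ ω ∈ Ω y, ∀ t < T, (path y ω t, path y ω (t + 1)) ∈ E t)
    (hcert : ∀ y, ∀ ω ∈ Ω y, ∃ C : Finset I, C ⊆ lab (path y ω T) ∧
      ∀ z : I → q, (∀ i ∈ C, z i = y.1 i) → f z)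
    (hinj : ∀ y, ∀ t < T, ∀ ω ∈ Ω y, ∀ ω' ∈ Ω y, path y ω t = path y ω' t →
      path y ω (t + 1) = path y ω' (t + 1) → ω = ω')
    (A B : ℕ → ℝ) (Q : ℝ) (hQ : 0 < Q) (hA : ∀ t < T, 0 < A t)
    (hsumA : ∀ t < T, ∑ e ∈ E t, ((lab e.2 \ lab e.1).card : ℝ) ≤ A t)
    (hsumB : ∀ y, ∀ t < T, ∑ ω ∈ Ω y,
      ((lab (path y ω (t + 1)) \ lab (path y ω t)).card : ℝ) ≤ ((Ω y).card : ℝ) ^ 2 * B t)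
    (hAB : ∀ t < T, A t * B t ≤ Q ^ 2) :
    ∃ G : LearningGraphFor f (ℕ × K), G.complexity ≤ T * Q := by
  let lift : ℕ → K × K → (ℕ × K) × (ℕ × K) := fun t e => ((t, e.1), (t + 1, e.2))
  let Edges : Finset ((ℕ × K) × (ℕ × K)) := (Finset.range T).biUnion fun t => (E t).image (lift t)
  let pe : {y : I → q // f y} → O → ℕ → (ℕ × K) × (ℕ × K) :=
    fun y ω t => lift t (path y ω t, path y ω (t + 1))
  let p : {y : I → q // f y} → (ℕ × K) × (ℕ × K) → ℝ := fun y e =>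
    (∑ ω ∈ Ω y, ∑ t ∈ Finset.range T, if pe y ω t = e then (1 : ℝ) else 0) / (Ω y).card
  have hlift : ∀ t, Function.Injective (lift t) := by
    rintro t ⟨u, v⟩ ⟨u', v'⟩ h
    simp only [lift, Prod.mk.injEq, true_and] at h
    exact Prod.ext h.1 h.2
  have hpe : ∀ y, ∀ ω ∈ Ω y, ∀ t < T, pe y ω t ∈ Edges := fun y ω hω t ht =>
    Finset.mem_biUnion.2 ⟨t, Finset.mem_range.2 ht,
      Finset.mem_image.2 ⟨_, hpathE y ω hω t ht, rfl⟩⟩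
  have hcard : ∀ y, (0 : ℝ) < (Ω y).card := fun y => by exact_mod_cast (hΩ y).card_pos
  have hsumE : ∀ F : (ℕ × K) × (ℕ × K) → ℝ,
      ∑ e ∈ Edges, F e = ∑ t ∈ Finset.range T, ∑ e ∈ E t, F (lift t e) := by
    intro F
    rw [Finset.sum_biUnion]
    · exact Finset.sum_congr rfl fun t _ => Finset.sum_image fun _ _ _ _ h => hlift t h
    · intro s _ t _ hst
      refine Finset.disjoint_left.2 fun e he he' => hst ?_
      obtain ⟨_, _, rfl⟩ := Finset.mem_image.1 he
      obtain ⟨_, _, h⟩ := Finset.mem_image.1 he'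
      simp only [lift, Prod.mk.injEq] at h
      exact h.1.1.symm
  have hflow : ∀ y (P : (ℕ × K) × (ℕ × K) → Prop) [DecidablePred P],
      ∑ e ∈ Edges.filter P, p y e =
      (∑ ω ∈ Ω y, ∑ t ∈ Finset.range T, if P (pe y ω t) then (1 : ℝ) else 0) / (Ω y).card := by
    intro y P _
    simp only [p]
    rw [← Finset.sum_div, Finset.sum_comm]
    congr 1
    refine Finset.sum_congr rfl fun ω hω => ?_
    rw [Finset.sum_comm]
    refine Finset.sum_congr rfl fun t ht => ?_
    rw [Finset.sum_ite_eq]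
    simp [Finset.mem_filter, hpe y ω hω t (Finset.mem_range.1 ht)]
  have hnet : ∀ y v [DecidablePred fun e : (ℕ × K) × (ℕ × K) => e.1 = v]
      [DecidablePred fun e : (ℕ × K) × (ℕ × K) => e.2 = v],
      (∑ e ∈ Edges.filter (fun e => e.1 = v), p y e)
      - (∑ e ∈ Edges.filter (fun e => e.2 = v), p y e) =
      (∑ ω ∈ Ω y, ((if (0, k₀) = v then (1 : ℝ) else 0) -
        if (T, path y ω T) = v then 1 else 0)) / (Ω y).card := by
    intro y v _ _
    rw [hflow, hflow, ← sub_div, ← Finset.sum_sub_distrib]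
    congr 1
    refine Finset.sum_congr rfl fun ω hω => ?_
    rw [← Finset.sum_sub_distrib]
    have := Finset.sum_range_sub' (fun t => if (t, path y ω t) = v then (1 : ℝ) else 0) T
    simp only [hpath₀ y ω hω] at this
    convert this using 3 <;> exact if_congr Iff.rfl rfl rfl
  let w : (ℕ × K) × (ℕ × K) → ℝ := fun e => if e.1.1 < T then Q / A e.1.1 else 1
  let G : LearningGraphFor f (ℕ × K) :=
    { root := (0, k₀)
      Edges := Edges
      w := w
      lab := fun v => lab v.2
      p := p
      w_pos := by
        intro e _
        by_cases h : e.1.1 < T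
        · simpa [w, h] using div_pos hQ (hA _ h)
        · simp [w, h]
      lab_root := hk₀
      lab_mono := by
        intro e he
        obtain ⟨t, ht, he⟩ := Finset.mem_biUnion.1 he
        obtain ⟨e', he', rfl⟩ := Finset.mem_image.1 he
        exact hE t (Finset.mem_range.1 ht) e' he'
      p_nonneg := fun y e => div_nonneg (Finset.sum_nonneg fun _ _ =>
        Finset.sum_nonneg fun _ _ => by split_ifs <;> norm_num) (hcard y).le
      p_supp := by
        intro y e he
        simp only [p]
        rw [Finset.sum_eq_zero, zero_div]
        intro ω hω
        refine Finset.sum_eq_zero fun t ht => if_neg ?_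
        rintro rfl
        exact he (hpe y ω hω t (Finset.mem_range.1 ht))
      unit_flow := by
        intro y
        rw [hnet]
        have : ∀ ω, (T, path y ω T) ≠ (0, k₀) := fun ω h => hT.ne' (Prod.ext_iff.1 h).1
        simp [this, (hcard y).ne']
      flow_cons := by
        intro y v hv
        rw [← sub_nonpos, hnet]
        refine div_nonpos_of_nonpos_of_nonneg (Finset.sum_nonpos fun ω _ => ?_) (hcard y).le
        rw [if_neg (Ne.symm hv)]
        split_ifs <;> norm_num
      sink_cert := by
        intro y v hv
        rw [← sub_neg, hnet] at hv
        by_contra hcon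
        refine not_le.2 hv (div_nonneg (Finset.sum_nonneg fun ω hω => ?_) (hcard y).le)
        rw [if_neg (c := (T, path y ω T) = v)]
        · split_ifs <;> norm_num
        · rintro rfl
          exact hcon (hcert y ω hω) }
  have hC0 : G.C0 ≤ T * Q := by
    change ∑ e ∈ Edges, ((lab e.2.2 \ lab e.1.2).card : ℝ) * w e ≤ _
    rw [hsumE]
    calc _ ≤ ∑ t ∈ Finset.range T, Q := Finset.sum_le_sum fun t ht => ?_
      _ = T * Q := by simp
    have ht' := Finset.mem_range.1 ht
    simp only [w, lift, ht', if_true]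
    rw [← Finset.sum_mul]
    calc _ ≤ A t * (Q / A t) :=
          mul_le_mul_of_nonneg_right (hsumA t ht') (div_pos hQ (hA t ht')).le
      _ = Q := mul_div_cancel₀ _ (hA t ht').ne'
  have hC1 : G.C1 ≤ T * Q := by
    refine Real.iSup_le (fun y => ?_) (by positivity)
    change ∑ e ∈ Edges, ((lab e.2.2 \ lab e.1.2).card : ℝ) / w e * p y e ^ 2 ≤ _
    rw [hsumE]
    calc _ ≤ ∑ t ∈ Finset.range T, Q := Finset.sum_le_sum fun t ht => ?_
      _ = T * Q := by simp
    have ht' := Finset.mem_range.1 ht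
    have hp : ∀ e, p y (lift t e) ^ 2 =
        (∑ ω ∈ Ω y, if (path y ω t, path y ω (t + 1)) = e then (1 : ℝ) else 0) /
          ((Ω y).card : ℝ) ^ 2 := by
      intro e
      have h1 : ∀ ω, (∑ s ∈ Finset.range T, if pe y ω s = lift t e then (1 : ℝ) else 0) =
          if (path y ω t, path y ω (t + 1)) = e then 1 else 0 := by
        intro ω
        rw [Finset.sum_eq_single t]
        · simp only [pe, (hlift t).eq_iff]
        · intro s _ hs
          refine if_neg fun h => hs ?_
          simp only [pe, lift, Prod.mk.injEq] at h
          exact h.1.1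
        · exact fun h => absurd ht h
      simp only [p, h1, div_pow]
      congr 1
      by_cases h : ∃ ω ∈ Ω y, (path y ω t, path y ω (t + 1)) = e
      · obtain ⟨ω, hω, rfl⟩ := h
        rw [Finset.sum_eq_single_of_mem ω hω]
        · simp
        · intro ω' hω' hne
          refine if_neg fun h => hne ?_
          exact hinj y t ht' _ hω' _ hω (Prod.ext_iff.1 h).1 (Prod.ext_iff.1 h).2
      · push Not at h
        rw [Finset.sum_eq_zero fun ω hω => if_neg (h ω hω)]
        norm_num
    simp only [hp]
    have hN := hcard y
    have key : ∑ e ∈ E t, ((lab e.2 \ lab e.1).card : ℝ) *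
        (∑ ω ∈ Ω y, if (path y ω t, path y ω (t + 1)) = e then (1 : ℝ) else 0) =
        ∑ ω ∈ Ω y, ((lab (path y ω (t + 1)) \ lab (path y ω t)).card : ℝ) := by
      simp only [Finset.mul_sum]
      rw [Finset.sum_comm]
      refine Finset.sum_congr rfl fun ω hω => ?_
      simp only [mul_ite, mul_one, mul_zero]
      rw [Finset.sum_ite_eq, if_pos (hpathE y ω hω t ht')]
    calc _ = (∑ e ∈ E t, ((lab e.2 \ lab e.1).card : ℝ) *
        (∑ ω ∈ Ω y, if (path y ω t, path y ω (t + 1)) = e then (1 : ℝ) else 0)) *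
          (A t / (Q * ((Ω y).card : ℝ) ^ 2)) := by
          rw [Finset.sum_mul]
          refine Finset.sum_congr rfl fun e _ => ?_
          have := (hA t ht').ne'
          simp only [lift, w, ht', if_true]
          field_simp
      _ ≤ ((Ω y).card : ℝ) ^ 2 * B t * (A t / (Q * ((Ω y).card : ℝ) ^ 2)) := by
          rw [key]
          exact mul_le_mul_of_nonneg_right (hsumB y t ht') (div_pos (hA t ht') (by positivity)).le
      _ = A t * B t / Q := by field_simp
      _ ≤ Q := by
          rw [div_le_iff₀ hQ, ← sq]
          exact hAB t ht'
  have hTQ : 0 ≤ T * Q := by positivity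
  refine ⟨G, Real.sqrt_le_iff.2 ⟨hTQ, ?_⟩⟩
  have hC1' : 0 ≤ G.C1 := Real.iSup_nonneg fun y => Finset.sum_nonneg fun e he =>
    mul_nonneg (div_nonneg (Nat.cast_nonneg _) (G.w_pos e he).le) (sq_nonneg _)
  rw [sq]
  exact mul_le_mul hC0 hC1 hC1' hTQ

/-- Querying every entry at once. -/
theorem exists_learningGraphFor_complexity_le_sq (n : ℕ) :
    ∃ G : LearningGraphFor (NotAssociative n) (ℕ × Finset (Fin n × Fin n)),
      G.complexity ≤ (n : ℝ) ^ 2 := by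
  rcases Nat.eq_zero_or_pos n with rfl | hn
  · have : IsEmpty {y : Fin 0 × Fin 0 → Fin 0 // NotAssociative 0 y} :=
      ⟨fun y => y.2.choose.elim0⟩
    refine ⟨⟨(0, ∅), ∅, fun _ => 1, fun _ => ∅, isEmptyElim, ?_, rfl, ?_, isEmptyElim,
      isEmptyElim, isEmptyElim, isEmptyElim, isEmptyElim⟩, ?_⟩
    · simp
    · simp
    · simp [LearningGraphFor.complexity, LearningGraphFor.C0]
  · have hn' : (0 : ℝ) < n := by exact_mod_cast hn
    have := exists_learningGraphFor_of_paths (f := NotAssociative n) (O := Unit) one_pos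
      (lab := fun s : Finset (Fin n × Fin n) => s) ∅ rfl (fun _ => {(∅, Finset.univ)})
      (by simp) (fun _ => {()}) (by simp) (fun _ _ t => if t = 0 then ∅ else Finset.univ)
      (by simp) (by simp) (by
        intro y _ _
        refine ⟨Finset.univ, by simp, fun z hz => ?_⟩
        rw [show z = y.1 from funext fun i => hz i (Finset.mem_univ i)]
        exact y.2) (by simp) (fun _ => (n : ℝ) ^ 2) (fun _ => (n : ℝ) ^ 2) ((n : ℝ) ^ 2)
      (by positivity) (fun _ _ => by positivity) (by simp [sq]) (by simp [sq])
      (by intro t _; rw [sq ((n : ℝ) ^ 2)])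
    simpa using this

end PathFlow

section Database

/-- A sequence of `m + 1` values of which the one at a distinguished position is missing. -/
abbrev Punctured (m : ℕ) (X : Type) : Type := Fin (m + 1) × (Fin m → X)

/-- The partial sequence obtained by placing `o` in the missing position. -/
def Punctured.plug {m : ℕ} {X : Type} (s : Punctured m X) (o : Option X) :
    Fin (m + 1) → Option X :=
  Fin.insertNth (α := fun _ => Option X) s.1 o fun x => some (s.2 x)

namespace Punctured

variable {m : ℕ} {X : Type}

@[simp] theorem plug_fst (s : Punctured m X) (o : Option X) : s.plug o s.1 = o := by
  simp [plug]

@[simp] theorem plug_succAbove (s : Punctured m X) (o : Option X) (x : Fin m) :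
    s.plug o (s.1.succAbove x) = some (s.2 x) := by
  simp [plug]

theorem plug_some_cases {s : Punctured m X} {v p : X} {x : Fin (m + 1)}
    (h : s.plug (some v) x = some p) : (x = s.1 ∧ p = v) ∨ s.plug none x = some p := by
  rcases Fin.eq_self_or_eq_succAbove s.1 x with rfl | ⟨x, rfl⟩
  · left
    simpa [eq_comm] using h
  · right
    simpa using h

theorem plug_none_cases {s : Punctured m X} {p : X} {x : Fin (m + 1)}
    (h : s.plug none x = some p) : ∃ x', x = s.1.succAbove x' ∧ s.2 x' = p := by
  rcases Fin.eq_self_or_eq_succAbove s.1 x with rfl | ⟨x, rfl⟩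
  · simp at h
  · rw [plug_succAbove, Option.some_inj] at h
    exact ⟨x, rfl, h⟩

theorem plug_some_of_plug_none {s : Punctured m X} (v : X) {p : X} {x : Fin (m + 1)}
    (h : s.plug none x = some p) : s.plug (some v) x = some p := by
  obtain ⟨x', rfl, rfl⟩ := plug_none_cases h
  simp

theorem plug_some_eq (s : Punctured m X) (v : X) :
    s.plug (some v) = fun x => some ((s.1.insertNth v s.2 : Fin (m + 1) → X) x) := by
  funext x
  rcases Fin.eq_self_or_eq_succAbove s.1 x with rfl | ⟨x, rfl⟩ <;> simp

theorem plug_injective {s s' : Punctured m X} {o : Option X}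
    (h : ∀ x, some (s'.2 x) ≠ o) (heq : s.plug o = s'.plug o) : s = s' := by
  have h1 : s.1 = s'.1 := by
    by_contra hne
    obtain ⟨x, hx⟩ := Fin.exists_succAbove_eq hne
    have := congrFun heq s.1
    rw [plug_fst, ← hx, plug_succAbove] at this
    exact h x this.symm
  refine Prod.ext h1 (funext fun x => ?_)
  have := congrFun heq (s.1.succAbove x)
  rw [plug_succAbove, h1, plug_succAbove] at this
  exact Option.some_injective _ this

end Punctured

/-- A partially filled database: three lists `A`, `B`, `C` of elements of `[n]`, a list `U` of
pairs of slots of `C` and `B`, a list `W` of pairs of a slot of `C` and an element of `[n]`, and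
possibly one pair `D` of a slot of `A` and an element of `[n]`. -/
structure Database (n a b g m : ℕ) where
  A : Fin (a + 1) → Option (Fin n)
  B : Fin (b + 1) → Option (Fin n)
  C : Fin (g + 1) → Option (Fin n)
  U : Fin (m + 1) → Option (Fin (g + 1) × Fin (b + 1))
  W : Fin (m + 1) → Option (Fin (g + 1) × Fin n)
  D : Option (Fin (a + 1) × Fin n)

namespace Database

variable {n a b g m : ℕ}

/-- The table entries that a database holds. -/
noncomputable def entries (k : Database n a b g m) : Finset (Fin n × Fin n) :=
  Finset.univ.filter fun r =>
    (∃ x y, k.A x = some r.1 ∧ k.B y = some r.2) ∨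
    (∃ l z y, k.U l = some (z, y) ∧ k.B y = some r.1 ∧ k.C z = some r.2) ∨
    (∃ l z, k.W l = some (z, r.1) ∧ k.C z = some r.2) ∨
    (∃ x, k.D = some (x, r.2) ∧ k.A x = some r.1)

theorem mem_entries {k : Database n a b g m} {p q : Fin n} :
    (p, q) ∈ k.entries ↔
      (∃ x y, k.A x = some p ∧ k.B y = some q) ∨
      (∃ l z y, k.U l = some (z, y) ∧ k.B y = some p ∧ k.C z = some q) ∨
      (∃ l z, k.W l = some (z, p) ∧ k.C z = some q) ∨
      (∃ x, k.D = some (x, q) ∧ k.A x = some p) := by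
  simp [entries]

/-- The database with nothing in it. -/
def empty : Database n a b g m :=
  ⟨fun _ => none, fun _ => none, fun _ => none, fun _ => none, fun _ => none, none⟩

theorem entries_empty : (empty : Database n a b g m).entries = ∅ := by
  ext ⟨p, q⟩
  simp [mem_entries, empty]

theorem entries_mono {k k' : Database n a b g m}
    (hA : ∀ x p, k.A x = some p → k'.A x = some p) (hB : ∀ x p, k.B x = some p → k'.B x = some p)
    (hC : ∀ x p, k.C x = some p → k'.C x = some p) (hU : ∀ x p, k.U x = some p → k'.U x = some p)
    (hW : ∀ x p, k.W x = some p → k'.W x = some p) (hD : ∀ p, k.D = some p → k'.D = some p) :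
    k.entries ⊆ k'.entries := by
  rintro ⟨p, q⟩ h
  rw [mem_entries] at h ⊢
  rcases h with ⟨x, y, h1, h2⟩ | ⟨l, z, y, h1, h2, h3⟩ | ⟨l, z, h1, h2⟩ | ⟨x, h1, h2⟩
  · exact .inl ⟨x, y, hA _ _ h1, hB _ _ h2⟩
  · exact .inr (.inl ⟨l, z, y, hU _ _ h1, hB _ _ h2, hC _ _ h3⟩)
  · exact .inr (.inr (.inl ⟨l, z, hW _ _ h1, hC _ _ h2⟩))
  · exact .inr (.inr (.inr ⟨x, hD _ h1, hA _ _ h2⟩))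

section Length

variable [NeZero n] (A : Fin (a + 1) → Option (Fin n)) (B : Fin (b + 1) → Option (Fin n))
  (C : Fin (g + 1) → Option (Fin n)) (U : Fin (m + 1) → Option (Fin (g + 1) × Fin (b + 1)))
  (W : Fin (m + 1) → Option (Fin (g + 1) × Fin n))

theorem card_entries_le :
    (entries ⟨A, B, C, U, W, none⟩).card ≤ (a + 1) * (b + 1) + 2 * (m + 1) := by
  let S : Finset (Fin n × Fin n) :=
    (Finset.univ.image fun i : Fin (a + 1) × Fin (b + 1) => ((A i.1).getD 0, (B i.2).getD 0)) ∪
    ((Finset.univ.image fun l : Fin (m + 1) =>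
        ((B ((U l).getD 0).2).getD 0, (C ((U l).getD 0).1).getD 0)) ∪
      Finset.univ.image fun l : Fin (m + 1) =>
        (((W l).getD 0).2, (C ((W l).getD 0).1).getD 0))
  have hS : entries ⟨A, B, C, U, W, none⟩ ⊆ S := by
    rintro ⟨p, q⟩ h
    rw [mem_entries] at h
    simp only [S, Finset.mem_union, Finset.mem_image, Finset.mem_univ, true_and]
    rcases h with ⟨x, y, h1, h2⟩ | ⟨l, z, y, h1, h2, h3⟩ | ⟨l, z, h1, h2⟩ | ⟨x, h1, h2⟩
    · exact .inl ⟨(x, y), by simp_all⟩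
    · exact .inr (.inl ⟨l, by simp_all⟩)
    · exact .inr (.inr ⟨l, by simp_all⟩)
    · simp at h1
  refine (Finset.card_le_card hS).trans ((Finset.card_union_le _ _).trans
    (add_le_add (Finset.card_image_le.trans (by simp)) ((Finset.card_union_le _ _).trans ?_)))
  rw [two_mul]
  exact add_le_add (Finset.card_image_le.trans (by simp)) (Finset.card_image_le.trans (by simp))

theorem card_entries_fill_A (s : Punctured a (Fin n)) (v : Fin n) :
    (entries ⟨s.plug (some v), B, C, U, W, none⟩ \
      entries ⟨s.plug none, B, C, U, W, none⟩).card ≤ b + 1 := by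
  have hS : entries ⟨s.plug (some v), B, C, U, W, none⟩ \
      entries ⟨s.plug none, B, C, U, W, none⟩ ⊆
      Finset.univ.image fun y : Fin (b + 1) => (v, (B y).getD 0) := by
    rintro ⟨p, q⟩ h
    rw [Finset.mem_sdiff, mem_entries, mem_entries] at h
    obtain ⟨h, hn⟩ := h
    rcases h with ⟨x, y, h1, h2⟩ | h | h | ⟨x, h1, h2⟩
    · rcases Punctured.plug_some_cases h1 with ⟨rfl, rfl⟩ | h1'
      · exact Finset.mem_image.2 ⟨y, by simp_all⟩
      · exact absurd (.inl ⟨x, y, h1', h2⟩) hn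
    · exact absurd (.inr (.inl h)) hn
    · exact absurd (.inr (.inr (.inl h))) hn
    · simp at h1
  exact (Finset.card_le_card hS).trans (Finset.card_image_le.trans (by simp))

theorem card_entries_fill_C (s : Punctured g (Fin n)) (v : Fin n)
    (u : Punctured m (Fin (g + 1) × Fin (b + 1))) (w : Punctured m (Fin (g + 1) × Fin n)) :
    (entries ⟨A, B, s.plug (some v), u.plug none, w.plug none, none⟩ \
      entries ⟨A, B, s.plug none, u.plug none, w.plug none, none⟩).card ≤
      (Finset.univ.filter fun x => (u.2 x).1 = s.1).card +
        (Finset.univ.filter fun x => (w.2 x).1 = s.1).card := by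
  let S : Finset (Fin n × Fin n) :=
    ((Finset.univ.filter fun x => (u.2 x).1 = s.1).image fun x => ((B (u.2 x).2).getD 0, v)) ∪
      (Finset.univ.filter fun x => (w.2 x).1 = s.1).image fun x => ((w.2 x).2, v)
  have hS : entries ⟨A, B, s.plug (some v), u.plug none, w.plug none, none⟩ \
      entries ⟨A, B, s.plug none, u.plug none, w.plug none, none⟩ ⊆ S := by
    rintro ⟨p, q⟩ h
    rw [Finset.mem_sdiff, mem_entries, mem_entries] at h
    obtain ⟨h, hn⟩ := h
    simp only [S, Finset.mem_union, Finset.mem_image, Finset.mem_filter, Finset.mem_univ, true_and]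
    rcases h with h | ⟨l, z, y, h1, h2, h3⟩ | ⟨l, z, h1, h2⟩ | ⟨x, h1, h2⟩
    · exact absurd (.inl h) hn
    · rcases Punctured.plug_some_cases h3 with ⟨rfl, rfl⟩ | h3'
      · obtain ⟨x, rfl, hx⟩ := Punctured.plug_none_cases h1
        exact .inl ⟨x, by simp_all⟩
      · exact absurd (.inr (.inl ⟨l, z, y, h1, h2, h3'⟩)) hn
    · rcases Punctured.plug_some_cases h2 with ⟨rfl, rfl⟩ | h2'
      · obtain ⟨x, rfl, hx⟩ := Punctured.plug_none_cases h1
        exact .inr ⟨x, by simp_all⟩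
      · exact absurd (.inr (.inr (.inl ⟨l, z, h1, h2'⟩))) hn
    · simp at h1
  exact (Finset.card_le_card hS).trans ((Finset.card_union_le _ _).trans
    (add_le_add Finset.card_image_le Finset.card_image_le))

theorem card_entries_fill_B (s : Punctured b (Fin n)) (v : Fin n)
    (u : Punctured m (Fin (g + 1) × Fin (b + 1))) :
    (entries ⟨A, s.plug (some v), C, u.plug none, W, none⟩ \
      entries ⟨A, s.plug none, C, u.plug none, W, none⟩).card ≤
      (a + 1) + (Finset.univ.filter fun x => (u.2 x).2 = s.1).card := by
  let S : Finset (Fin n × Fin n) :=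
    (Finset.univ.image fun x => ((A x).getD 0, v)) ∪
      (Finset.univ.filter fun x => (u.2 x).2 = s.1).image fun x => (v, (C (u.2 x).1).getD 0)
  have hS : entries ⟨A, s.plug (some v), C, u.plug none, W, none⟩ \
      entries ⟨A, s.plug none, C, u.plug none, W, none⟩ ⊆ S := by
    rintro ⟨p, q⟩ h
    rw [Finset.mem_sdiff, mem_entries, mem_entries] at h
    obtain ⟨h, hn⟩ := h
    simp only [S, Finset.mem_union, Finset.mem_image, Finset.mem_filter, Finset.mem_univ, true_and]
    rcases h with ⟨x, y, h1, h2⟩ | ⟨l, z, y, h1, h2, h3⟩ | h | ⟨x, h1, h2⟩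
    · rcases Punctured.plug_some_cases h2 with ⟨rfl, rfl⟩ | h2'
      · exact .inl ⟨x, by simp_all⟩
      · exact absurd (.inl ⟨x, y, h1, h2'⟩) hn
    · rcases Punctured.plug_some_cases h2 with ⟨rfl, rfl⟩ | h2'
      · obtain ⟨x, rfl, hx⟩ := Punctured.plug_none_cases h1
        exact .inr ⟨x, by simp_all⟩
      · exact absurd (.inr (.inl ⟨l, z, y, h1, h2', h3⟩)) hn
    · exact absurd (.inr (.inr (.inl h))) hn
    · simp at h1
  exact (Finset.card_le_card hS).trans ((Finset.card_union_le _ _).trans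
    (add_le_add (Finset.card_image_le.trans (by simp)) Finset.card_image_le))

theorem card_entries_fill_U (s : Punctured m (Fin (g + 1) × Fin (b + 1)))
    (v : Fin (g + 1) × Fin (b + 1)) :
    (entries ⟨A, B, C, s.plug (some v), W, none⟩ \
      entries ⟨A, B, C, s.plug none, W, none⟩).card ≤ 1 := by
  have hS : entries ⟨A, B, C, s.plug (some v), W, none⟩ \
      entries ⟨A, B, C, s.plug none, W, none⟩ ⊆ {((B v.2).getD 0, (C v.1).getD 0)} := by
    rintro ⟨p, q⟩ h
    rw [Finset.mem_sdiff, mem_entries, mem_entries] at h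
    obtain ⟨h, hn⟩ := h
    rcases h with h | ⟨l, z, y, h1, h2, h3⟩ | h | ⟨x, h1, h2⟩
    · exact absurd (.inl h) hn
    · rcases Punctured.plug_some_cases h1 with ⟨rfl, rfl⟩ | h1'
      · simp_all
      · exact absurd (.inr (.inl ⟨l, z, y, h1', h2, h3⟩)) hn
    · exact absurd (.inr (.inr (.inl h))) hn
    · simp at h1
  exact (Finset.card_le_card hS).trans (by simp)

theorem card_entries_fill_W (s : Punctured m (Fin (g + 1) × Fin n)) (v : Fin (g + 1) × Fin n) :
    (entries ⟨A, B, C, U, s.plug (some v), none⟩ \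
      entries ⟨A, B, C, U, s.plug none, none⟩).card ≤ 1 := by
  have hS : entries ⟨A, B, C, U, s.plug (some v), none⟩ \
      entries ⟨A, B, C, U, s.plug none, none⟩ ⊆ {(v.2, (C v.1).getD 0)} := by
    rintro ⟨p, q⟩ h
    rw [Finset.mem_sdiff, mem_entries, mem_entries] at h
    obtain ⟨h, hn⟩ := h
    rcases h with h | h | ⟨l, z, h1, h2⟩ | ⟨x, h1, h2⟩
    · exact absurd (.inl h) hn
    · exact absurd (.inr (.inl h)) hn
    · rcases Punctured.plug_some_cases h1 with ⟨rfl, rfl⟩ | h1'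
      · simp_all
      · exact absurd (.inr (.inr (.inl ⟨l, z, h1', h2⟩))) hn
    · simp at h1
  exact (Finset.card_le_card hS).trans (by simp)

theorem card_entries_fill_D (v : Fin (a + 1) × Fin n) :
    (entries ⟨A, B, C, U, W, some v⟩ \ entries ⟨A, B, C, U, W, none⟩).card ≤ 1 := by
  have hS : entries ⟨A, B, C, U, W, some v⟩ \ entries ⟨A, B, C, U, W, none⟩ ⊆
      {((A v.1).getD 0, v.2)} := by
    rintro ⟨p, q⟩ h
    rw [Finset.mem_sdiff, mem_entries, mem_entries] at h
    obtain ⟨h, hn⟩ := h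
    rcases h with h | h | h | ⟨x, h1, h2⟩
    · exact absurd (.inl h) hn
    · exact absurd (.inr (.inl h)) hn
    · exact absurd (.inr (.inr (.inl h))) hn
    · simp_all
  exact (Finset.card_le_card hS).trans (by simp)

end Length

/-- Elements `a, b, c` together with the values `d = b ∘ c` and `e = a ∘ b`. -/
structure Witness (n : ℕ) where
  a : Fin n
  b : Fin n
  c : Fin n
  d : Fin n
  e : Fin n

/-- A database with one entry missing in each of its five lists. -/
abbrev Seed (n a b g m : ℕ) : Type :=
  Punctured a (Fin n) × Punctured b (Fin n) × Punctured g (Fin n) ×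
    Punctured m (Fin (g + 1) × Fin (b + 1)) × Punctured m (Fin (g + 1) × Fin n)

/-- The path that loads a seed and then completes it one entry at a time, in the order
`A`, `C`, `B`, `U`, `W`, `D`, by the data of the witness. -/
def path (κ : Witness n) (ω : Seed n a b g m) : ℕ → Database n a b g m
  | 0 => empty
  | t + 1 =>
    { A := ω.1.plug (if 1 ≤ t then some κ.a else none)
      B := ω.2.1.plug (if 3 ≤ t then some κ.b else none)
      C := ω.2.2.1.plug (if 2 ≤ t then some κ.c else none)
      U := ω.2.2.2.1.plug (if 4 ≤ t then some (ω.2.2.1.1, ω.2.1.1) else none)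
      W := ω.2.2.2.2.plug (if 5 ≤ t then some (ω.2.2.1.1, κ.e) else none)
      D := if 6 ≤ t then some (ω.1.1, κ.d) else none }

/-- The seed does not already contain any of the entries supplied by the witness. -/
def Avoids (κ : Witness n) (ω : Seed n a b g m) : Prop :=
  (∀ x, ω.1.2 x ≠ κ.a) ∧ (∀ x, ω.2.1.2 x ≠ κ.b) ∧ (∀ x, ω.2.2.1.2 x ≠ κ.c) ∧
    (∀ x, ω.2.2.2.1.2 x ≠ (ω.2.2.1.1, ω.2.1.1)) ∧ ∀ x, ω.2.2.2.2.2 x ≠ (ω.2.2.1.1, κ.e)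

theorem path_succ_injective {κ : Witness n} {ω ω' : Seed n a b g m} (h : Avoids κ ω')
    {t : ℕ} (heq : path κ ω (t + 1) = path κ ω' (t + 1)) : ω = ω' := by
  obtain ⟨sA, sB, sC, u, w⟩ := ω
  obtain ⟨sA', sB', sC', u', w'⟩ := ω'
  obtain ⟨hA, hB, hC, hU, hW⟩ := h
  simp only [path, Database.mk.injEq] at heq
  obtain ⟨eA, eB, eC, eU, eW, -⟩ := heq
  have avoid : ∀ {l : ℕ} {X : Type} {s : Punctured l X} {v : X} (P : Prop) [Decidable P],
      (∀ x, s.2 x ≠ v) → ∀ x, some (s.2 x) ≠ if P then some v else none := by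
    intro l X s v P _ hs x
    split_ifs
    · exact fun h => hs x (Option.some_injective _ h)
    · exact Option.some_ne_none _
  obtain rfl := Punctured.plug_injective (avoid _ hA) eA
  obtain rfl := Punctured.plug_injective (avoid _ hB) eB
  obtain rfl := Punctured.plug_injective (avoid _ hC) eC
  obtain rfl := Punctured.plug_injective (avoid _ hU) eU
  obtain rfl := Punctured.plug_injective (avoid _ hW) eW
  rfl

theorem exists_certificate {y : Fin n × Fin n → Fin n} {κ : Witness n}
    (hd : y (κ.b, κ.c) = κ.d) (he : y (κ.a, κ.b) = κ.e) (hne : y (κ.a, κ.d) ≠ y (κ.e, κ.c))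
    (ω : Seed n a b g m) :
    ∃ S : Finset (Fin n × Fin n), S ⊆ (path κ ω 7).entries ∧
      ∀ z : Fin n × Fin n → Fin n, (∀ i ∈ S, z i = y i) → NotAssociative n z := by
  refine ⟨{(κ.a, κ.b), (κ.b, κ.c), (κ.e, κ.c), (κ.a, κ.d)}, ?_, fun z hz => ?_⟩
  · intro i hi
    simp only [Finset.mem_insert, Finset.mem_singleton] at hi
    rcases hi with rfl | rfl | rfl | rfl <;> rw [mem_entries]
    · exact .inl ⟨ω.1.1, ω.2.1.1, by simp [path], by simp [path]⟩
    · exact .inr (.inl ⟨ω.2.2.2.1.1, ω.2.2.1.1, ω.2.1.1, by simp [path], by simp [path],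
        by simp [path]⟩)
    · exact .inr (.inr (.inl ⟨ω.2.2.2.2.1, ω.2.2.1.1, by simp [path], by simp [path]⟩))
    · exact .inr (.inr (.inr ⟨ω.1.1, by simp [path], by simp [path]⟩))
  · refine ⟨κ.a, κ.b, κ.c, ?_⟩
    rw [hz (κ.b, κ.c) (by simp), hz (κ.a, κ.b) (by simp), hd, he, hz (κ.a, κ.d) (by simp),
      hz (κ.e, κ.c) (by simp)]
    exact hne

/-- Edges that load a seed. -/
def edgeSeed (ω : Seed n a b g m) : Database n a b g m × Database n a b g m :=
  (empty, ⟨ω.1.plug none, ω.2.1.plug none, ω.2.2.1.plug none, ω.2.2.2.1.plug none,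
    ω.2.2.2.2.plug none, none⟩)

/-- Edges that complete the list `A`. -/
def edgeA (θ : Fin n × Seed n a b g m) : Database n a b g m × Database n a b g m :=
  (⟨θ.2.1.plug none, θ.2.2.1.plug none, θ.2.2.2.1.plug none, θ.2.2.2.2.1.plug none,
    θ.2.2.2.2.2.plug none, none⟩,
   ⟨θ.2.1.plug (some θ.1), θ.2.2.1.plug none, θ.2.2.2.1.plug none, θ.2.2.2.2.1.plug none,
    θ.2.2.2.2.2.plug none, none⟩)

/-- Edges that complete the list `C`; the completed slot is the last component. -/
def edgeC (θ : ((Fin (a + 1) → Fin n) × Punctured b (Fin n) × (Fin n × (Fin g → Fin n)) ×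
    Punctured m (Fin (g + 1) × Fin (b + 1)) × Punctured m (Fin (g + 1) × Fin n)) × Fin (g + 1)) :
    Database n a b g m × Database n a b g m :=
  (⟨fun x => some (θ.1.1 x), θ.1.2.1.plug none,
    Punctured.plug (θ.2, θ.1.2.2.1.2) none, θ.1.2.2.2.1.plug none, θ.1.2.2.2.2.plug none, none⟩,
   ⟨fun x => some (θ.1.1 x), θ.1.2.1.plug none,
    Punctured.plug (θ.2, θ.1.2.2.1.2) (some θ.1.2.2.1.1), θ.1.2.2.2.1.plug none,
    θ.1.2.2.2.2.plug none, none⟩)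

/-- Edges that complete the list `B`; the completed slot is the last component. -/
def edgeB (θ : ((Fin (a + 1) → Fin n) × (Fin n × (Fin b → Fin n)) × (Fin (g + 1) → Fin n) ×
    Punctured m (Fin (g + 1) × Fin (b + 1)) × Punctured m (Fin (g + 1) × Fin n)) × Fin (b + 1)) :
    Database n a b g m × Database n a b g m :=
  (⟨fun x => some (θ.1.1 x), Punctured.plug (θ.2, θ.1.2.1.2) none,
    fun x => some (θ.1.2.2.1 x), θ.1.2.2.2.1.plug none, θ.1.2.2.2.2.plug none, none⟩,
   ⟨fun x => some (θ.1.1 x), Punctured.plug (θ.2, θ.1.2.1.2) (some θ.1.2.1.1),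
    fun x => some (θ.1.2.2.1 x), θ.1.2.2.2.1.plug none, θ.1.2.2.2.2.plug none, none⟩)

/-- Edges that complete the list `U`. -/
def edgeU (θ : (Fin (a + 1) → Fin n) × (Fin (b + 1) → Fin n) × (Fin (g + 1) → Fin n) ×
    ((Fin (g + 1) × Fin (b + 1)) × Punctured m (Fin (g + 1) × Fin (b + 1))) ×
    Punctured m (Fin (g + 1) × Fin n)) : Database n a b g m × Database n a b g m :=
  (⟨fun x => some (θ.1 x), fun x => some (θ.2.1 x), fun x => some (θ.2.2.1 x),
    θ.2.2.2.1.2.plug none, θ.2.2.2.2.plug none, none⟩,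
   ⟨fun x => some (θ.1 x), fun x => some (θ.2.1 x), fun x => some (θ.2.2.1 x),
    θ.2.2.2.1.2.plug (some θ.2.2.2.1.1), θ.2.2.2.2.plug none, none⟩)

/-- Edges that complete the list `W`. -/
def edgeW (θ : (Fin (a + 1) → Fin n) × (Fin (b + 1) → Fin n) × (Fin (g + 1) → Fin n) ×
    (Fin (m + 1) → Fin (g + 1) × Fin (b + 1)) ×
    ((Fin (g + 1) × Fin n) × Punctured m (Fin (g + 1) × Fin n))) :
    Database n a b g m × Database n a b g m :=
  (⟨fun x => some (θ.1 x), fun x => some (θ.2.1 x), fun x => some (θ.2.2.1 x),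
    fun x => some (θ.2.2.2.1 x), θ.2.2.2.2.2.plug none, none⟩,
   ⟨fun x => some (θ.1 x), fun x => some (θ.2.1 x), fun x => some (θ.2.2.1 x),
    fun x => some (θ.2.2.2.1 x), θ.2.2.2.2.2.plug (some θ.2.2.2.2.1), none⟩)

/-- Edges that choose the pair `D`. -/
def edgeD (θ : (Fin (a + 1) → Fin n) × (Fin (b + 1) → Fin n) × (Fin (g + 1) → Fin n) ×
    (Fin (m + 1) → Fin (g + 1) × Fin (b + 1)) × (Fin (m + 1) → Fin (g + 1) × Fin n) ×
    (Fin (a + 1) × Fin n)) : Database n a b g m × Database n a b g m :=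
  (⟨fun x => some (θ.1 x), fun x => some (θ.2.1 x), fun x => some (θ.2.2.1 x),
    fun x => some (θ.2.2.2.1 x), fun x => some (θ.2.2.2.2.1 x), none⟩,
   ⟨fun x => some (θ.1 x), fun x => some (θ.2.1 x), fun x => some (θ.2.2.1 x),
    fun x => some (θ.2.2.2.1 x), fun x => some (θ.2.2.2.2.1 x), some θ.2.2.2.2.2⟩)

/-- The edges of each layer. -/
noncomputable def edges : ℕ → Finset (Database n a b g m × Database n a b g m)
  | 0 => Finset.univ.image edgeSeed
  | 1 => Finset.univ.image edgeA
  | 2 => Finset.univ.image edgeC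
  | 3 => Finset.univ.image edgeB
  | 4 => Finset.univ.image edgeU
  | 5 => Finset.univ.image edgeW
  | 6 => Finset.univ.image edgeD
  | _ => ∅

theorem path_mem_edges (κ : Witness n) (ω : Seed n a b g m) {t : ℕ} (ht : t < 7) :
    (path κ ω t, path κ ω (t + 1)) ∈ edges t := by
  obtain ⟨sA, sB, sC, u, w⟩ := ω
  interval_cases t <;> simp only [edges, Finset.mem_image, Finset.mem_univ, true_and]
  · exact ⟨(sA, sB, sC, u, w), by simp [path, edgeSeed]⟩
  · exact ⟨(κ.a, sA, sB, sC, u, w), by simp [path, edgeA]⟩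
  · exact ⟨((sA.1.insertNth κ.a sA.2, sB, (κ.c, sC.2), u, w), sC.1),
      by simp [path, edgeC, Punctured.plug_some_eq sA]⟩
  · exact ⟨((sA.1.insertNth κ.a sA.2, (κ.b, sB.2), sC.1.insertNth κ.c sC.2, u, w), sB.1),
      by simp [path, edgeB, Punctured.plug_some_eq sA, Punctured.plug_some_eq sC]⟩
  · exact ⟨(sA.1.insertNth κ.a sA.2, sB.1.insertNth κ.b sB.2, sC.1.insertNth κ.c sC.2,
      ((sC.1, sB.1), u), w), by simp [path, edgeU, Punctured.plug_some_eq sA,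
        Punctured.plug_some_eq sB, Punctured.plug_some_eq sC]⟩
  · exact ⟨(sA.1.insertNth κ.a sA.2, sB.1.insertNth κ.b sB.2, sC.1.insertNth κ.c sC.2,
      u.1.insertNth (sC.1, sB.1) u.2, (sC.1, κ.e), w), by simp [path, edgeW,
        Punctured.plug_some_eq sA, Punctured.plug_some_eq sB, Punctured.plug_some_eq sC,
        Punctured.plug_some_eq u]⟩
  · exact ⟨(sA.1.insertNth κ.a sA.2, sB.1.insertNth κ.b sB.2, sC.1.insertNth κ.c sC.2,
      u.1.insertNth (sC.1, sB.1) u.2, w.1.insertNth (sC.1, κ.e) w.2, (sA.1, κ.d)),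
      by simp [path, edgeD, Punctured.plug_some_eq]⟩

theorem entries_subset_of_mem_edges {t : ℕ} {e : Database n a b g m × Database n a b g m}
    (he : e ∈ edges t) : e.1.entries ⊆ e.2.entries := by
  unfold edges at he
  split at he
  case h_8 => simp at he
  case h_1 =>
    obtain ⟨ω, -, rfl⟩ := Finset.mem_image.1 he
    simp [edgeSeed, entries_empty]
  all_goals
    obtain ⟨θ, -, rfl⟩ := Finset.mem_image.1 he
    apply entries_mono <;>
      simp only [edgeA, edgeC, edgeB, edgeU, edgeW, edgeD, imp_self, implies_true, reduceCtorEq,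
        false_imp_iff] <;>
      exact fun _ _ h => Punctured.plug_some_of_plug_none _ h

section Sums

theorem sum_image_univ_le {Θ K : Type} [Fintype Θ] [DecidableEq K] (φ : Θ → K) (F : K → ℕ) :
    ∑ e ∈ Finset.univ.image φ, F e ≤ ∑ θ, F (φ θ) :=
  Finset.sum_image_le_of_nonneg fun _ _ => Nat.zero_le _

theorem sum_card_fiber {X : Type} {k : ℕ} (φ : Fin m → X) (ψ : X → Fin k) :
    ∑ i : Fin k, (Finset.univ.filter fun x => ψ (φ x) = i).card = m := by
  have := Finset.card_eq_sum_card_fiberwise (s := (Finset.univ : Finset (Fin m)))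
    (t := (Finset.univ : Finset (Fin k))) (f := fun x => ψ (φ x)) (fun _ _ => by simp)
  simpa using this.symm

/-- The length of an edge. -/
noncomputable def len (e : Database n a b g m × Database n a b g m) : ℕ :=
  (e.2.entries \ e.1.entries).card

/-- The number of seeds. -/
def seeds (n a b g m : ℕ) : ℕ :=
  ((a + 1) * n ^ a) * (((b + 1) * n ^ b) * (((g + 1) * n ^ g) *
    (((m + 1) * ((g + 1) * (b + 1)) ^ m) * ((m + 1) * ((g + 1) * n) ^ m))))

/-- The average length of the edges of each layer. -/
noncomputable def avgLen (a b g m : ℕ) : ℕ → ℝ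
  | 0 => (a + 1) * (b + 1) + 2 * (m + 1)
  | 1 => b + 1
  | 2 => 2 * (m + 1) / (g + 1)
  | 3 => (a + 1) + (m + 1) / (b + 1)
  | _ => 1

/-- The number of edges of each layer divided by the number of seeds. -/
noncomputable def edgeRatio (n a g m : ℕ) : ℕ → ℝ
  | 0 => 1
  | 1 => n
  | 2 => n ^ 2 / (a + 1)
  | 3 => n ^ 3 / ((a + 1) * (g + 1))
  | 4 => n ^ 3 / (a + 1)
  | 5 => n ^ 4 * (g + 1) / ((a + 1) * (m + 1))
  | _ => n ^ 5 * (g + 1) / (m + 1) ^ 2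

theorem sum_len_edges_le {Θ : Type} [Fintype Θ]
    (φ : Θ → Database n a b g m × Database n a b g m) {c : ℕ} (h : ∀ θ, len (φ θ) ≤ c) {Q : ℝ}
    (hQ : (Fintype.card Θ : ℝ) * c = Q) : ∑ e ∈ Finset.univ.image φ, (len e : ℝ) ≤ Q := by
  rw [← hQ, ← Nat.cast_sum, ← Nat.cast_mul, Nat.cast_le]
  refine (sum_image_univ_le φ len).trans ?_
  exact (Finset.sum_le_card_nsmul _ _ c fun θ _ => h θ).trans (by simp)

theorem sum_len_edges_prod_le {Θ : Type} [Fintype Θ] {k : ℕ}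
    (φ : Θ × Fin k → Database n a b g m × Database n a b g m) {c : ℕ}
    (h : ∀ θ, ∑ i, len (φ (θ, i)) ≤ c) {Q : ℝ} (hQ : (Fintype.card Θ : ℝ) * c = Q) :
    ∑ e ∈ Finset.univ.image φ, (len e : ℝ) ≤ Q := by
  rw [← hQ, ← Nat.cast_sum, ← Nat.cast_mul, Nat.cast_le]
  refine (sum_image_univ_le φ len).trans ?_
  rw [Fintype.sum_prod_type]
  exact (Finset.sum_le_card_nsmul _ _ c fun θ _ => h θ).trans (by simp)

/-- Reordering of the data of a seed so that the position of the missing entry of `C` is last. -/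
def seedEquivC : ((Punctured a (Fin n) × Punctured b (Fin n) × (Fin g → Fin n) ×
    Punctured m (Fin (g + 1) × Fin (b + 1)) × Punctured m (Fin (g + 1) × Fin n)) × Fin (g + 1)) ≃
    Seed n a b g m where
  toFun θ := (θ.1.1, θ.1.2.1, (θ.2, θ.1.2.2.1), θ.1.2.2.2.1, θ.1.2.2.2.2)
  invFun ω := ((ω.1, ω.2.1, ω.2.2.1.2, ω.2.2.2.1, ω.2.2.2.2), ω.2.2.1.1)
  left_inv _ := rfl
  right_inv _ := rfl

/-- Reordering of the data of a seed so that the position of the missing entry of `B` is last. -/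
def seedEquivB : ((Punctured a (Fin n) × (Fin b → Fin n) × Punctured g (Fin n) ×
    Punctured m (Fin (g + 1) × Fin (b + 1)) × Punctured m (Fin (g + 1) × Fin n)) × Fin (b + 1)) ≃
    Seed n a b g m where
  toFun θ := (θ.1.1, (θ.2, θ.1.2.1), θ.1.2.2.1, θ.1.2.2.2.1, θ.1.2.2.2.2)
  invFun ω := ((ω.1, ω.2.1.2, ω.2.2.1, ω.2.2.2.1, ω.2.2.2.2), ω.2.1.1)
  left_inv _ := rfl
  right_inv _ := rfl

theorem sum_seed_le (F : Seed n a b g m → ℕ) {c : ℕ} (h : ∀ ω, F ω ≤ c) {Q : ℝ}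
    (hQ : (Fintype.card (Seed n a b g m) : ℝ) * c = Q) : ∑ ω, (F ω : ℝ) ≤ Q := by
  rw [← hQ, ← Nat.cast_sum, ← Nat.cast_mul, Nat.cast_le]
  exact (Finset.sum_le_card_nsmul _ _ c fun θ _ => h θ).trans (by simp)

theorem sum_seed_equiv_le {Θ : Type} [Fintype Θ] {k : ℕ} (φ : Θ × Fin k ≃ Seed n a b g m)
    (F : Seed n a b g m → ℕ) {c : ℕ} (h : ∀ θ, ∑ i, F (φ (θ, i)) ≤ c) {Q : ℝ}
    (hQ : (Fintype.card Θ : ℝ) * c = Q) : ∑ ω, (F ω : ℝ) ≤ Q := by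
  rw [← hQ, ← Nat.cast_sum, ← Nat.cast_mul, Nat.cast_le, ← φ.sum_comp, Fintype.sum_prod_type]
  exact (Finset.sum_le_card_nsmul _ _ c fun θ _ => h θ).trans (by simp)

variable [NeZero n]

theorem sum_len_edgeC (A : Fin (a + 1) → Fin n) (sB : Punctured b (Fin n))
    (c : Fin n) (s : Fin g → Fin n) (u : Punctured m (Fin (g + 1) × Fin (b + 1)))
    (w : Punctured m (Fin (g + 1) × Fin n)) :
    ∑ i, len (edgeC ((A, sB, (c, s), u, w), i)) ≤ 2 * m := by
  refine (Finset.sum_le_sum fun i _ => card_entries_fill_C _ _ (i, s) c u w).trans ?_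
  rw [Finset.sum_add_distrib]
  simp only [sum_card_fiber, two_mul, le_refl]

theorem sum_len_edgeB (A : Fin (a + 1) → Fin n) (c : Fin n) (s : Fin b → Fin n)
    (C : Fin (g + 1) → Fin n) (u : Punctured m (Fin (g + 1) × Fin (b + 1)))
    (w : Punctured m (Fin (g + 1) × Fin n)) :
    ∑ i, len (edgeB ((A, (c, s), C, u, w), i)) ≤ (b + 1) * (a + 1) + m := by
  refine (Finset.sum_le_sum fun i _ => card_entries_fill_B _ _ _ (i, s) c u).trans ?_
  rw [Finset.sum_add_distrib]
  simp [sum_card_fiber]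

theorem sum_len_edges {t : ℕ} (ht : t < 7) :
    ∑ e ∈ edges t, (len (e : Database n a b g m × Database n a b g m) : ℝ) ≤
      edgeRatio n a g m t * seeds n a b g m * avgLen a b g m t := by
  interval_cases t
  · apply sum_len_edges_le edgeSeed (c := (a + 1) * (b + 1) + 2 * (m + 1))
    · intro ω
      simpa [len, edgeSeed, entries_empty] using
        card_entries_le (ω.1.plug none) (ω.2.1.plug none) (ω.2.2.1.plug none)
          (ω.2.2.2.1.plug none) (ω.2.2.2.2.plug none)
    · simp [edgeRatio, avgLen, seeds]
  · apply sum_len_edges_le edgeA fun θ => card_entries_fill_A _ _ _ _ _ _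
    simp [edgeRatio, avgLen, seeds]
  · apply sum_len_edges_prod_le edgeC fun θ => (sum_len_edgeC _ _ _ _ _ _).trans
      (Nat.mul_le_mul_left 2 m.le_succ)
    simp [edgeRatio, avgLen, seeds]
    field_simp
    ring
  · apply sum_len_edges_prod_le edgeB fun θ => (sum_len_edgeB _ _ _ _ _ _).trans
      (Nat.add_le_add_left m.le_succ _)
    simp [edgeRatio, avgLen, seeds]
    field_simp
    ring
  · apply sum_len_edges_le edgeU fun θ => card_entries_fill_U _ _ _ _ _ _
    simp [edgeRatio, avgLen, seeds]
    field_simp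
    ring
  · apply sum_len_edges_le edgeW fun θ => card_entries_fill_W _ _ _ _ _ _
    simp [edgeRatio, avgLen, seeds]
    field_simp
    ring
  · apply sum_len_edges_le edgeD fun θ => card_entries_fill_D _ _ _ _ _ _
    simp [edgeRatio, avgLen, seeds]
    field_simp
    ring

theorem sum_len_path (κ : Witness n) {t : ℕ} (ht : t < 7) :
    ∑ ω : Seed n a b g m, (len (path κ ω t, path κ ω (t + 1)) : ℝ) ≤
      seeds n a b g m * avgLen a b g m t := by
  interval_cases t
  · apply sum_seed_le _ (c := (a + 1) * (b + 1) + 2 * (m + 1))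
    · intro ω
      simpa [len, path, entries_empty] using
        card_entries_le (ω.1.plug none) (ω.2.1.plug none) (ω.2.2.1.plug none)
          (ω.2.2.2.1.plug none) (ω.2.2.2.2.plug none)
    · simp [avgLen, seeds]
  · apply sum_seed_le _ fun ω => card_entries_fill_A _ _ _ _ _ _
    simp [avgLen, seeds]
  · apply sum_seed_equiv_le seedEquivC _ (c := 2 * (m + 1))
    · rintro ⟨sA, sB, s, u, w⟩
      refine (Finset.sum_le_sum fun i _ => card_entries_fill_C _ _ (i, s) κ.c u w).trans ?_
      rw [Finset.sum_add_distrib, sum_card_fiber, sum_card_fiber]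
      omega
    · simp [avgLen, seeds]
      field_simp
  · apply sum_seed_equiv_le seedEquivB _ (c := (b + 1) * (a + 1) + (m + 1))
    · rintro ⟨sA, s, sC, u, w⟩
      refine (Finset.sum_le_sum fun i _ => card_entries_fill_B _ _ _ (i, s) κ.b u).trans ?_
      rw [Finset.sum_add_distrib, sum_card_fiber]
      simp
    · simp [avgLen, seeds]
      field_simp
  · apply sum_seed_le _ fun ω => card_entries_fill_U _ _ _ _ _ _
    simp [avgLen, seeds]
  · apply sum_seed_le _ fun ω => card_entries_fill_W _ _ _ _ _ _
    simp [avgLen, seeds]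
  · apply sum_seed_le _ fun ω => card_entries_fill_D _ _ _ _ _ _
    simp [avgLen, seeds]

end Sums

section Avoiding

/-- A predicate that holds for at least a fraction `1 / k` of the elements of a type. -/
def Frequent {X : Type} [Fintype X] (k : ℕ) (P : X → Prop) : Prop :=
  Fintype.card X ≤ k * (Finset.univ.filter P).card

theorem Frequent.prod {X Y : Type} [Fintype X] [Fintype Y] {k l : ℕ} {P : X → Prop}
    {R : X → Y → Prop} (hP : Frequent k P) (hR : ∀ x, Frequent l (R x)) :
    Frequent (k * l) fun z : X × Y => P z.1 ∧ R z.1 z.2 := by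
  unfold Frequent at *
  have h : (Finset.univ.filter P).card * Fintype.card Y ≤
      l * (Finset.univ.filter fun z : X × Y => P z.1 ∧ R z.1 z.2).card := by
    have h1 : (Finset.univ.filter fun z : X × Y => P z.1 ∧ R z.1 z.2).card =
        ∑ x ∈ Finset.univ.filter P, (Finset.univ.filter (R x)).card := by
      rw [← Finset.card_sigma]
      refine Finset.card_bij' (fun z _ => ⟨z.1, z.2⟩) (fun z _ => (z.1, z.2)) ?_ ?_ ?_ ?_ <;> simp
    rw [h1, Finset.mul_sum, ← smul_eq_mul]
    exact Finset.card_nsmul_le_sum _ _ _ fun x _ => hR x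
  calc Fintype.card (X × Y) = Fintype.card X * Fintype.card Y := Fintype.card_prod X Y
    _ ≤ k * ((Finset.univ.filter P).card * Fintype.card Y) := by
      rw [← mul_assoc]; exact Nat.mul_le_mul_right _ hP
    _ ≤ _ := by rw [mul_assoc]; convert Nat.mul_le_mul_left k h

theorem card_forall_ne {X : Type} [Fintype X] (m : ℕ) (v : X) :
    (Finset.univ.filter fun f : Fin m → X => ∀ x, f x ≠ v).card = (Fintype.card X - 1) ^ m := by
  have : (Finset.univ.filter fun f : Fin m → X => ∀ x, f x ≠ v) =
      Fintype.piFinset fun _ => Finset.univ.erase v := by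
    ext f
    simp
  rw [this]
  simp

theorem pow_le_two_mul_pred_pow {N m : ℕ} (hN : 0 < N) (h : 2 * m ≤ N) :
    N ^ m ≤ 2 * (N - 1) ^ m := by
  obtain ⟨M, rfl⟩ : ∃ M, N = M + 1 := ⟨N - 1, by omega⟩
  have hM : (0 : ℝ) < (M + 1 : ℝ) := by positivity
  have h2 : (2 * m : ℝ) ≤ M + 1 := by exact_mod_cast h
  have key := one_add_mul_le_pow (a := -(1 / (M + 1 : ℝ)))
    (by rw [neg_le_neg_iff, div_le_iff₀ hM]; linarith [(Nat.cast_nonneg M : (0 : ℝ) ≤ M)]) m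
  have h3 : (1 : ℝ) / 2 ≤ (1 + -(1 / (M + 1 : ℝ))) ^ m := by
    refine le_trans ?_ key
    have : (m : ℝ) * (1 / (M + 1)) ≤ 1 / 2 := by
      rw [mul_one_div, div_le_iff₀ hM]; linarith
    linarith
  have h4 : (1 + -(1 / (M + 1 : ℝ))) = M / (M + 1) := by field_simp; ring
  rw [h4, div_pow, le_div_iff₀ (by positivity)] at h3
  have : ((M + 1 : ℕ) : ℝ) ^ m ≤ 2 * (M : ℝ) ^ m := by push_cast; linarith
  exact_mod_cast this

theorem frequent_forall_ne {X : Type} [Fintype X] {m : ℕ} (h : 2 * m ≤ Fintype.card X) (v : X) :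
    Frequent 2 fun s : Punctured m X => ∀ x, s.2 x ≠ v := by
  have h1 : Frequent 1 fun _ : Fin (m + 1) => True := by simp [Frequent]
  have h2 : Frequent 2 fun f : Fin m → X => ∀ x, f x ≠ v := by
    have := pow_le_two_mul_pred_pow (Fintype.card_pos_iff.2 ⟨v⟩) h
    rw [← card_forall_ne] at this
    rw [Frequent, Fintype.card_fun, Fintype.card_fin]
    convert this
  simpa using h1.prod fun _ => h2

theorem frequent_avoids (κ : Witness n) (ha : 2 * a ≤ n) (hb : 2 * b ≤ n) (hg : 2 * g ≤ n)
    (hu : 2 * m ≤ (g + 1) * (b + 1)) (hw : 2 * m ≤ (g + 1) * n) :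
    Frequent 32 (Avoids κ : Seed n a b g m → Prop) := by
  refine (frequent_forall_ne (by simpa) κ.a).prod (k := 2) (l := 16) fun sA =>
    (frequent_forall_ne (by simpa) κ.b).prod (k := 2) (l := 8) fun sB =>
      (frequent_forall_ne (by simpa) κ.c).prod (k := 2) (l := 4) fun sC =>
        (frequent_forall_ne (by simpa) (sC.1, sB.1)).prod (k := 2) (l := 2) fun u =>
          frequent_forall_ne (by simpa) (sC.1, κ.e)

end Avoiding

theorem exists_learningGraphFor [NeZero n] (ha : 2 * a ≤ n) (hb : 2 * b ≤ n) (hg : 2 * g ≤ n)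
    (hu : 2 * m ≤ (g + 1) * (b + 1)) (hw : 2 * m ≤ (g + 1) * n) {Q : ℝ} (hQ : 0 < Q)
    (h : ∀ t < 7, 1024 * edgeRatio n a g m t * avgLen a b g m t ^ 2 ≤ Q ^ 2) :
    ∃ G : LearningGraphFor (NotAssociative n) (ℕ × Database n a b g m), G.complexity ≤ 7 * Q := by
  have hn : (0 : ℝ) < n := Nat.cast_pos.2 (NeZero.pos n)
  have hZ : (0 : ℝ) < seeds n a b g m := by
    unfold seeds
    push_cast
    positivity
  have hκ : ∀ y : {y : Fin n × Fin n → Fin n // NotAssociative n y}, ∃ κ : Witness n,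
      y.1 (κ.b, κ.c) = κ.d ∧ y.1 (κ.a, κ.b) = κ.e ∧ y.1 (κ.a, κ.d) ≠ y.1 (κ.e, κ.c) := by
    rintro ⟨y, a, b, c, hy⟩
    exact ⟨⟨a, b, c, y (b, c), y (a, b)⟩, rfl, rfl, hy⟩
  choose κ hd he hne using hκ
  have hcard : ∀ y, (seeds n a b g m : ℝ) ≤
      32 * (Finset.univ.filter (Avoids (κ y) : Seed n a b g m → Prop)).card := by
    intro y
    have := frequent_avoids (κ y) ha hb hg hu hw
    have hs : Fintype.card (Seed n a b g m) = seeds n a b g m := by simp [seeds]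
    rw [Frequent, hs] at this
    exact_mod_cast this
  have hpos : ∀ t, 0 < avgLen a b g m t ∧ 0 < edgeRatio n a g m t := by
    intro t
    constructor
    · unfold avgLen
      split <;> positivity
    · unfold edgeRatio
      split <;> positivity
  have hA : ∀ t < 7, ∑ e ∈ edges t, (len (e : Database n a b g m × Database n a b g m) : ℝ) ≤
      edgeRatio n a g m t * seeds n a b g m * avgLen a b g m t := fun t ht => sum_len_edges ht
  have hB : ∀ y, ∀ t < 7, ∑ ω ∈ Finset.univ.filter (Avoids (κ y) : Seed n a b g m → Prop),
      (len (path (κ y) ω t, path (κ y) ω (t + 1)) : ℝ) ≤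
        ((Finset.univ.filter (Avoids (κ y) : Seed n a b g m → Prop)).card : ℝ) ^ 2 *
          (1024 * avgLen a b g m t / seeds n a b g m) := by
    intro y t ht
    calc _ ≤ ∑ ω : Seed n a b g m, (len (path (κ y) ω t, path (κ y) ω (t + 1)) : ℝ) :=
          Finset.sum_le_sum_of_subset_of_nonneg (Finset.subset_univ _)
            fun _ _ _ => Nat.cast_nonneg _
      _ ≤ seeds n a b g m * avgLen a b g m t := sum_len_path (κ y) ht
      _ = (seeds n a b g m / 32) ^ 2 * (1024 * avgLen a b g m t / seeds n a b g m) := by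
          field_simp
          norm_num
      _ ≤ ((Finset.univ.filter (Avoids (κ y) : Seed n a b g m → Prop)).card : ℝ) ^ 2 *
          (1024 * avgLen a b g m t / seeds n a b g m) := by
          refine mul_le_mul_of_nonneg_right (pow_le_pow_left₀ (by positivity) ?_ 2)
            (div_nonneg (mul_nonneg (by norm_num) (hpos t).1.le) hZ.le)
          linarith [hcard y]
  have := exists_learningGraphFor_of_paths (f := NotAssociative n) (T := 7) (by norm_num)
    (entries : Database n a b g m → _) empty entries_empty edges
    (fun t _ e he => entries_subset_of_mem_edges he)
    (fun y => Finset.univ.filter (Avoids (κ y) : Seed n a b g m → Prop)) ?_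
    (fun y => path (κ y)) (fun _ _ _ => rfl) (fun y ω _ t ht => path_mem_edges (κ y) ω ht)
    (fun y ω _ => exists_certificate (hd y) (he y) (hne y) ω)
    (fun y t _ ω _ ω' h' _ heq => path_succ_injective (Finset.mem_filter.1 h').2 heq)
    (fun t => edgeRatio n a g m t * seeds n a b g m * avgLen a b g m t)
    (fun t => 1024 * avgLen a b g m t / seeds n a b g m) Q hQ ?_ ?_ ?_ ?_
  · simpa using this
  · intro y
    rw [← Finset.card_pos, ← Nat.cast_pos (α := ℝ)]
    linarith [hcard y]
  · exact fun t _ => mul_pos (mul_pos (hpos t).2 hZ) (hpos t).1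
  · intro t ht
    convert hA t ht
    simp only [len]
    congr!
  · intro y t ht
    convert hB y t ht
    simp only [len]
    congr!
  · intro t ht
    refine le_of_eq_of_le ?_ (h t ht)
    field_simp

end Database

end Database

/-- With lists of sizes `x ^ 4`, `x ^ 6`, `x ^ 5` and `x ^ 10`, every layer is affordable. -/
theorem Database.edgeRatio_mul_avgLen_sq_le {n a b g m : ℕ} {x : ℝ} (hx : 1 ≤ x)
    (hn : (n : ℝ) ≤ 128 * x ^ 7) (ha : (a + 1 : ℝ) = x ^ 4) (hb : (b + 1 : ℝ) = x ^ 6)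
    (hg : (g + 1 : ℝ) = x ^ 5) (hm : (m + 1 : ℝ) = x ^ 10) {t : ℕ} (ht : t < 7) :
    1024 * Database.edgeRatio n a g m t * Database.avgLen a b g m t ^ 2 ≤
      (2 ^ 23 * x ^ 10) ^ 2 := by
  have hx0 : 0 < x := by linarith
  have hx20 : 0 < x ^ 20 := by positivity
  interval_cases t <;> simp only [Database.edgeRatio, Database.avgLen, ha, hb, hg, hm]
  · ring_nf
    linarith
  · calc 1024 * (n : ℝ) * (x ^ 6) ^ 2 ≤ 1024 * (128 * x ^ 7) * (x ^ 6) ^ 2 := by gcongr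
      _ = 131072 * x ^ 19 := by ring
      _ ≤ 131072 * x ^ 20 := by gcongr; norm_num
      _ ≤ _ := by ring_nf; linarith
  · calc 1024 * ((n : ℝ) ^ 2 / x ^ 4) * (2 * x ^ 10 / x ^ 5) ^ 2
        ≤ 1024 * ((128 * x ^ 7) ^ 2 / x ^ 4) * (2 * x ^ 10 / x ^ 5) ^ 2 := by gcongr
      _ = 67108864 * x ^ 20 := by field_simp; ring
      _ ≤ _ := by ring_nf; linarith
  · calc 1024 * ((n : ℝ) ^ 3 / (x ^ 4 * x ^ 5)) * (x ^ 4 + x ^ 10 / x ^ 6) ^ 2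
        ≤ 1024 * ((128 * x ^ 7) ^ 3 / (x ^ 4 * x ^ 5)) * (x ^ 4 + x ^ 10 / x ^ 6) ^ 2 := by gcongr
      _ = 8589934592 * x ^ 20 := by field_simp; ring
      _ ≤ _ := by ring_nf; linarith
  · calc 1024 * ((n : ℝ) ^ 3 / x ^ 4) * 1 ^ 2 ≤ 1024 * ((128 * x ^ 7) ^ 3 / x ^ 4) * 1 ^ 2 := by
          gcongr
      _ = 2147483648 * x ^ 17 := by field_simp; ring
      _ ≤ 2147483648 * x ^ 20 := by gcongr; norm_num
      _ ≤ _ := by ring_nf; linarith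
  · calc 1024 * ((n : ℝ) ^ 4 * x ^ 5 / (x ^ 4 * x ^ 10)) * 1 ^ 2
        ≤ 1024 * ((128 * x ^ 7) ^ 4 * x ^ 5 / (x ^ 4 * x ^ 10)) * 1 ^ 2 := by gcongr
      _ = 274877906944 * x ^ 19 := by field_simp; ring
      _ ≤ 274877906944 * x ^ 20 := by gcongr; norm_num
      _ ≤ _ := by ring_nf; linarith
  · calc 1024 * ((n : ℝ) ^ 5 * x ^ 5 / (x ^ 10) ^ 2) * 1 ^ 2
        ≤ 1024 * ((128 * x ^ 7) ^ 5 * x ^ 5 / (x ^ 10) ^ 2) * 1 ^ 2 := by gcongr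
      _ = 35184372088832 * x ^ 20 := by field_simp; ring
      _ ≤ _ := by ring_nf; linarith

theorem exists_seventh_root {n : ℕ} (hn : 128 ≤ n) :
    ∃ t : ℕ, 2 ≤ t ∧ t ^ 7 ≤ n ∧ n ≤ 128 * t ^ 7 := by
  refine ⟨Nat.findGreatest (fun t => t ^ 7 ≤ n) n, ?_⟩
  have h2 : 2 ≤ Nat.findGreatest (fun t => t ^ 7 ≤ n) n :=
    Nat.le_findGreatest (by omega) (by norm_num; exact hn)
  have h1 : (Nat.findGreatest (fun t => t ^ 7 ≤ n) n) ^ 7 ≤ n :=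
    Nat.findGreatest_spec (P := fun t => t ^ 7 ≤ n) (Nat.zero_le n) (by simp)
  refine ⟨h2, h1, ?_⟩
  set t := Nat.findGreatest (fun t => t ^ 7 ≤ n) n
  by_contra! hlt
  have h3 : (t + 1) ^ 7 ≤ n := by
    calc (t + 1) ^ 7 ≤ (2 * t) ^ 7 := Nat.pow_le_pow_left (by omega) 7
      _ = 128 * t ^ 7 := by ring
      _ ≤ n := hlt.le
  have h4 : t + 1 ≤ n := (Nat.le_self_pow (by norm_num) (t + 1)).trans h3
  have := Nat.le_findGreatest (P := fun t => t ^ 7 ≤ n) h4 h3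
  omega

theorem exists_learningGraphFor_complexity_le {n : ℕ} (hn : 128 ≤ n) :
    ∃ (V : Type) (G : LearningGraphFor (NotAssociative n) V),
      G.complexity ≤ 7 * 2 ^ 23 * (n : ℝ) ^ ((10 : ℝ) / 7) := by
  obtain ⟨t, ht, htn, hnt⟩ := exists_seventh_root hn
  have : NeZero n := ⟨by omega⟩
  have ht0 : 0 < t := by omega
  have hsub : ∀ k, t ^ k - 1 + 1 = t ^ k := fun k =>
    Nat.sub_add_cancel (Nat.one_le_pow k t ht0)
  have hcast : ∀ k, ((t ^ k - 1 : ℕ) : ℝ) + 1 = (t : ℝ) ^ k := fun k => by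
    exact_mod_cast hsub k
  have hle : ∀ i j, i < j → 2 * (t ^ i - 1) ≤ t ^ j := by
    intro i j hij
    calc 2 * (t ^ i - 1) ≤ t * t ^ i := Nat.mul_le_mul ht (Nat.sub_le _ _)
      _ = t ^ (i + 1) := by ring
      _ ≤ t ^ j := Nat.pow_le_pow_right ht0 hij
  have hle' : ∀ i, i < 7 → 2 * (t ^ i - 1) ≤ n := fun i hi => (hle i 7 hi).trans htn
  have ht1 : (1 : ℝ) ≤ t := by exact_mod_cast ht0
  obtain ⟨G, hG⟩ := Database.exists_learningGraphFor (n := n) (a := t ^ 4 - 1) (b := t ^ 6 - 1)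
    (g := t ^ 5 - 1) (m := t ^ 10 - 1) (hle' 4 (by norm_num)) (hle' 6 (by norm_num))
    (hle' 5 (by norm_num)) (by rw [hsub, hsub, ← pow_add]; exact hle 10 11 (by norm_num))
    (by
      rw [hsub]
      refine (hle 10 12 (by norm_num)).trans ?_
      rw [pow_add t 5 7]
      exact Nat.mul_le_mul_left _ htn)
    (Q := 2 ^ 23 * (t : ℝ) ^ 10) (by positivity)
    fun i hi => Database.edgeRatio_mul_avgLen_sq_le ht1 (by exact_mod_cast hnt) (hcast 4) (hcast 6)
      (hcast 5) (hcast 10) hi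
  refine ⟨_, G, hG.trans ?_⟩
  have h10 : (t : ℝ) ^ 10 ≤ (n : ℝ) ^ ((10 : ℝ) / 7) := by
    calc (t : ℝ) ^ 10 = ((t : ℝ) ^ 7) ^ ((10 : ℝ) / 7) := by
          rw [← Real.rpow_natCast, ← Real.rpow_natCast, ← Real.rpow_mul (by positivity)]
          norm_num
      _ ≤ _ := Real.rpow_le_rpow (by positivity) (by exact_mod_cast htn) (by norm_num)
  linarith

/-- the learning graph complexity of associativity testing is
`O(n^{10/7})`: there is a universal constant `c > 0` such that for every `n`
there is a learning graph for the non-associativity function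
`f : [n]^{n×n} → {0,1}` of complexity at most `c·n^{10/7}` (hence, by Belovs'
theorem, a bounded-error `O(n^{10/7})`-query quantum algorithm deciding whether
a black-box operation `∘ : S × S → S` with `|S| = n` is associative). -/
theorem associativity_learning_graph_complexity :
    ∃ c : ℝ, 0 < c ∧ ∀ n : ℕ,
      ∃ (V : Type) (G : LearningGraphFor (NotAssociative n) V),
        G.complexity ≤ c * (n : ℝ) ^ ((10 : ℝ) / 7) := by
  refine ⟨7 * 2 ^ 23, by norm_num, fun n => ?_⟩
  rcases le_or_gt 128 n with hn | hn
  · exact exists_learningGraphFor_complexity_le hn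
  obtain ⟨G, hG⟩ := exists_learningGraphFor_complexity_le_sq n
  refine ⟨_, G, hG.trans ?_⟩
  rcases Nat.eq_zero_or_pos n with rfl | hpos
  · norm_num
  have h1 : (1 : ℝ) ≤ n := by exact_mod_cast hpos
  have h2 : (n : ℝ) ≤ 128 := by exact_mod_cast hn.le
  have h3 : (n : ℝ) ≤ (n : ℝ) ^ ((10 : ℝ) / 7) := by
    simpa using Real.rpow_le_rpow_of_exponent_le h1 (by norm_num : (1 : ℝ) ≤ 10 / 7)
  nlinarith
end
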